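/- Let (X,T) be a topological dynamical system on a compact metric space satisfying the specification property, r ≥ 1 an integer, Φ : X^r → ℝ continuous, and α ∈ ℝ. If M_Φ(α) = ∅ then E_Φ(α) = ∅; and if M_Φ(α) ≠ ∅ then h_top(E_Φ(α)) = sup_{μ ∈ M_Φ(α)} h_μ. -/

import Mathlib

open MeasureTheory Filter Topology
open scoped ENNReal NNReal

section Defs

variable {X : Type*} [MetricSpace X]

/-- The Bowen ball `B_n(x, ε)` for the dynamics `T`. -/
def bowenBall (T : X → X) (n : ℕ) (ε : ℝ) (x : X) : Set X :=
  {y | ∀ j < n, dist (T^[j] x) (T^[j] y) < ε}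

/-- `H^s_n(Z, ε)`: infimum of `∑ exp(-s n_i)` over countable covers of `Z` by Bowen balls
`B_{n_i}(x_i, ε)` with `n_i ≥ n`. -/
noncomputable def bowenHn (T : X → X) (Z : Set X) (s ε : ℝ) (n : ℕ) : ℝ≥0∞ :=
  ⨅ (c : ℕ → X × ℕ) (_ : Z ⊆ ⋃ i, bowenBall T (c i).2 ε (c i).1) (_ : ∀ i, n ≤ (c i).2),
    ∑' i, ENNReal.ofReal (Real.exp (-(s * ((c i).2 : ℝ))))

/-- `H^s(Z, ε) = lim_n H^s_n(Z, ε)` (the quantities are nondecreasing in `n`). -/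
noncomputable def bowenH (T : X → X) (Z : Set X) (s ε : ℝ) : ℝ≥0∞ :=
  ⨆ n : ℕ, bowenHn T Z s ε n

/-- `h_top(Z, ε)`: the critical value of `s ↦ H^s(Z, ε)`. -/
noncomputable def bowenEnt (T : X → X) (Z : Set X) (ε : ℝ) : ℝ≥0∞ :=
  ⨅ (s : ℝ≥0) (_ : bowenH T Z s ε = 0), (s : ℝ≥0∞)

/-- Bowen's topological entropy of an arbitrary subset `Z ⊆ X`:
`h_top(Z) = lim_{ε → 0} h_top(Z, ε)`. -/
noncomputable def htop (T : X → X) (Z : Set X) : ℝ≥0∞ :=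
  ⨆ (ε : ℝ) (_ : 0 < ε), bowenEnt T Z ε

variable [MeasurableSpace X]

/-- Shannon entropy of the finite measurable partition of `X` induced by `P : X → ι`. -/
noncomputable def partEntropy {ι : Type} [Fintype ι] (μ : Measure X) (P : X → ι) : ℝ :=
  ∑ i : ι, Real.negMulLog ((μ (P ⁻¹' {i})).toReal)

/-- The measure-theoretic (Kolmogorov–Sinai) entropy `h_μ(T)`: supremum over finite measurable
partitions `P` of `lim_n (1/n) H_μ(P ∨ T⁻¹P ∨ ⋯ ∨ T^{-(n-1)}P)`, the limit being the
infimum by subadditivity. -/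
noncomputable def hKS (T : X → X) (μ : Measure X) : ℝ≥0∞ :=
  ⨆ (k : ℕ) (P : X → Fin k) (_ : Measurable P),
    ENNReal.ofReal (⨅ n : ℕ,
      partEntropy μ (fun x => fun j : Fin (n + 1) => P (T^[(j : ℕ)] x)) / (n + 1))

/-- The V-statistics `V_Φ(n, x) = n^{-r} ∑_{1 ≤ i_1, …, i_r ≤ n} Φ(T^{i_1}x, …, T^{i_r}x)`. -/
noncomputable def Vstat {r : ℕ} (T : X → X) (Φ : (Fin r → X) → ℝ) (n : ℕ) (x : X) : ℝ :=
  (∑ i : Fin r → Fin n, Φ (fun j => T^[(i j : ℕ) + 1] x)) / (n : ℝ) ^ r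

/-- The level set `E_Φ(α) = {x : lim_n V_Φ(n,x) = α}`. -/
def Eset {r : ℕ} (T : X → X) (Φ : (Fin r → X) → ℝ) (α : ℝ) : Set X :=
  {x | Tendsto (fun n => Vstat T Φ n x) atTop (𝓝 α)}

/-- The fiber `M_Φ(α)`: the `T`-invariant Borel probability measures `μ` with
`∫_{X^r} Φ dμ^{⊗r} = α`. -/
def Mset {r : ℕ} (T : X → X) (Φ : (Fin r → X) → ℝ) (α : ℝ) : Set (Measure X) :=
  {μ | IsProbabilityMeasure μ ∧ MeasurePreserving T μ μ ∧
    ∫ y, Φ y ∂(Measure.pi fun _ : Fin r => μ) = α}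

/-- The specification property: for every `ε > 0` there is `m(ε) ≥ 1` such that any finite
collection of pieces of orbits, with consecutive time gaps at least `m(ε)`, can be
`ε`-shadowed by the orbit of a single point. -/
def Specification (T : X → X) : Prop :=
  ∀ ε : ℝ, 0 < ε → ∃ m : ℕ, 1 ≤ m ∧
    ∀ k : ℕ, 2 ≤ k → ∀ (x : Fin k → X) (a b : Fin k → ℕ),
      (∀ i, a i ≤ b i) →
      (∀ i : Fin k, ∀ h : (i : ℕ) + 1 < k, b i + m ≤ a ⟨(i : ℕ) + 1, h⟩) →
      ∃ y : X, ∀ i : Fin k, ∀ n : ℕ, a i + n ≤ b i →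
        dist (T^[a i + n] y) (T^[n] (x i)) < ε

end Defs


section Emp
variable {X : Type*} [MeasurableSpace X]

/-- Uniform empirical measure of a finite family of points. -/
noncomputable def emp {ι : Type*} [Fintype ι] (u : ι → X) : Measure X :=
  (Fintype.card ι : ℝ≥0∞)⁻¹ • ∑ i, Measure.dirac (u i)

theorem emp_apply {ι : Type*} [Fintype ι] (u : ι → X) {s : Set X} (hs : MeasurableSet s) :
    emp u s = (Fintype.card ι : ℝ≥0∞)⁻¹ * ∑ i, s.indicator 1 (u i) := by
  simp [emp, Measure.smul_apply, Measure.finsetSum_apply, hs]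

theorem emp_isProb {ι : Type*} [Fintype ι] [Nonempty ι] (u : ι → X) :
    IsProbabilityMeasure (emp u) := by
  constructor
  rw [emp_apply u MeasurableSet.univ]
  simp
  exact ENNReal.inv_mul_cancel (by simp) (by simp)

theorem integral_emp [MeasurableSingletonClass X] {ι : Type*} [Fintype ι] (u : ι → X)
    (f : X → ℝ) :
    ∫ x, f x ∂(emp u) = (∑ i, f (u i)) / (Fintype.card ι : ℝ) := by
  unfold emp
  rw [integral_smul_measure, integral_finsetSum_measure]
  · simp [div_eq_inv_mul]
  · intro i _
    exact (integrable_dirac (by simp))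

theorem pi_emp {ι : Type*} [Fintype ι] [Nonempty ι] (u : ι → X) (r : ℕ) :
    Measure.pi (fun _ : Fin r => emp u) = emp (fun (i : Fin r → ι) (j : Fin r) => u (i j)) := by
  classical
  have := emp_isProb u
  refine Measure.pi_eq ?_
  intro s hs
  rw [emp_apply _ (MeasurableSet.univ_pi hs)]
  simp_rw [emp_apply u (hs _)]
  rw [Finset.prod_mul_distrib, Finset.prod_univ_sum]
  congr 1
  · simp [ENNReal.inv_pow]
  · refine Finset.sum_congr (by simp) ?_
    intro i _
    by_cases h : ∀ j, u (i j) ∈ s j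
    · rw [Set.indicator_of_mem (by simpa [Set.mem_pi] using h)]
      symm
      apply Finset.prod_eq_one
      intro j _
      rw [Set.indicator_of_mem (h j)]; rfl
    · rw [Set.indicator_of_notMem (by simpa [Set.mem_pi] using h)]
      push Not at h
      obtain ⟨j, hj⟩ := h
      symm
      apply Finset.prod_eq_zero (Finset.mem_univ j)
      rw [Set.indicator_of_notMem hj]

theorem Vstat_eq {X : Type*} [MetricSpace X] [CompactSpace X] [MeasurableSpace X] [BorelSpace X]
    {r : ℕ} (T : X → X) (Φ : (Fin r → X) → ℝ) (n : ℕ) (hn : n ≠ 0) (x : X) :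
    Vstat T Φ n x =
      ∫ y, Φ y ∂(Measure.pi fun _ : Fin r => emp (fun i : Fin n => T^[(i : ℕ) + 1] x)) := by
  have : Nonempty (Fin n) := ⟨⟨0, Nat.pos_of_ne_zero hn⟩⟩
  rw [pi_emp, integral_emp]
  simp [Vstat]

end Emp

section Weak
variable {X : Type*} [MetricSpace X] [CompactSpace X] [MeasurableSpace X] [BorelSpace X]

theorem tendsto_integral_pi {r : ℕ} {Φ : (Fin r → X) → ℝ} (hΦ : Continuous Φ)
    {γ : Type*} {l : Filter γ} {ν : γ → ProbabilityMeasure X} {μ : ProbabilityMeasure X}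
    (h : Tendsto ν l (𝓝 μ)) :
    Tendsto (fun j => ∫ y, Φ y ∂(Measure.pi fun _ : Fin r => (ν j : Measure X))) l
      (𝓝 (∫ y, Φ y ∂(Measure.pi fun _ : Fin r => (μ : Measure X)))) := by
  have h1 : Tendsto (fun j => ProbabilityMeasure.pi (fun _ : Fin r => ν j)) l
      (𝓝 (ProbabilityMeasure.pi (fun _ : Fin r => μ))) := by
    have := (ProbabilityMeasure.continuous_pi (ι := Fin r) (α := fun _ => X)).tendsto
      (fun _ => μ)
    exact this.comp (tendsto_pi_nhds.2 fun _ => h)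
  have h2 := (ProbabilityMeasure.tendsto_iff_forall_integral_tendsto.1 h1)
    (BoundedContinuousFunction.mkOfCompact ⟨Φ, hΦ⟩)
  simpa using h2

/-- closeness of averages under `T` gives an invariant limit -/
theorem invariant_of_limit {T : X → X} (hT : Continuous T) {γ : Type*} {l : Filter γ} [l.NeBot]
    {ν : γ → ProbabilityMeasure X} {μ : ProbabilityMeasure X} (h : Tendsto ν l (𝓝 μ))
    (hinv : ∀ f : C(X, ℝ), Tendsto (fun j => ∫ x, f (T x) ∂(ν j : Measure X) -
      ∫ x, f x ∂(ν j : Measure X)) l (𝓝 0)) :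
    MeasurePreserving T (μ : Measure X) (μ : Measure X) := by
  refine ⟨hT.measurable, ?_⟩
  have : IsProbabilityMeasure ((μ : Measure X).map T) :=
    Measure.isProbabilityMeasure_map hT.measurable.aemeasurable
  apply ext_of_forall_integral_eq_of_IsFiniteMeasure
  intro f
  rw [integral_map hT.measurable.aemeasurable f.continuous.aestronglyMeasurable]
  have h1 := (ProbabilityMeasure.tendsto_iff_forall_integral_tendsto.1 h) f
  have h2 := (ProbabilityMeasure.tendsto_iff_forall_integral_tendsto.1 h)
    (f.compContinuous ⟨T, hT⟩)
  have h3 := hinv f.toContinuousMap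
  have h4 := h2.sub h1
  have := tendsto_nhds_unique h4 h3
  simp at this
  linarith

end Weak


section Lim
variable {X : Type*} [MetricSpace X] [CompactSpace X] [MeasurableSpace X] [BorelSpace X]

theorem same_type_integral {r q : ℕ} {Φ : (Fin r → X) → ℝ} (hΦ : Continuous Φ)
    (m m' : Measure X) [IsProbabilityMeasure m] [IsProbabilityMeasure m']
    (Q : X → Fin q) (hQ : Measurable Q) (hmap : m.map Q = m'.map Q) (ω : ℝ)
    (hω : ∀ y y' : Fin r → X, (∀ j, Q (y j) = Q (y' j)) → |Φ y - Φ y'| ≤ ω) :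
    |∫ y, Φ y ∂(Measure.pi fun _ : Fin r => m) - ∫ y, Φ y ∂(Measure.pi fun _ : Fin r => m')|
      ≤ 2 * ω := by
  classical
  have hne : Nonempty X := nonempty_of_isProbabilityMeasure m
  let rep : Fin q → X := fun l => if h : ∃ x, Q x = l then h.choose else Classical.arbitrary X
  have hrep : ∀ x, Q (rep (Q x)) = Q x := by
    intro x
    have h : ∃ y, Q y = Q x := ⟨x, rfl⟩
    simp only [rep, dif_pos h]
    exact h.choose_spec
  have key : ∀ (m : Measure X) [IsProbabilityMeasure m],
      |∫ y, Φ y ∂(Measure.pi fun _ : Fin r => m) -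
        ∫ l, Φ (fun j => rep (l j)) ∂(Measure.pi fun _ : Fin r => m.map Q)| ≤ ω := by
    intro m _
    have : IsProbabilityMeasure (m.map Q) :=
      Measure.isProbabilityMeasure_map hQ.aemeasurable
    have h1 : Measure.pi (fun _ : Fin r => m.map Q) =
        (Measure.pi (fun _ : Fin r => m)).map (fun y j => Q (y j)) := by
      rw [Measure.pi_map_pi (fun _ => hQ.aemeasurable)]
    have hmQ : Measurable (fun (y : Fin r → X) (j : Fin r) => Q (y j)) := by fun_prop
    rw [h1, integral_map hmQ.aemeasurable
      (measurable_of_countable _).aestronglyMeasurable]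
    have hi1 : Integrable Φ (Measure.pi fun _ : Fin r => m) :=
      hΦ.integrable_of_hasCompactSupport (HasCompactSupport.of_compactSpace _)
    have hi2 : Integrable (fun y : Fin r → X => Φ (fun j => rep (Q (y j))))
        (Measure.pi fun _ : Fin r => m) := by
      have := (Integrable.of_finite (μ := (Measure.pi (fun _ : Fin r => m)).map (fun y j => Q (y j)))
        (f := fun l : Fin r → Fin q => Φ (fun j => rep (l j))))
      exact this.comp_measurable hmQ
    rw [← integral_sub hi1 hi2]
    have := norm_integral_le_of_norm_le_const (μ := Measure.pi fun _ : Fin r => m)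
      (f := fun y => Φ y - Φ (fun j => rep (Q (y j)))) (C := ω)
      (Filter.Eventually.of_forall fun y => by
        rw [Real.norm_eq_abs]
        exact hω _ _ fun j => (hrep _).symm)
    simpa using this
  have h1 := key m
  have h2 := key m'
  rw [hmap] at h1
  rw [abs_le] at *
  constructor <;> linarith [h1.1, h1.2, h2.1, h2.2]

/-- the orbit-averaged measure attached to a finite set of points -/
noncomputable def orb (T : X → X) (S : Finset X) (n : ℕ) : Measure X :=
  emp (fun p : S × Fin n => T^[(p.2 : ℕ) + 1] (p.1 : X))

theorem integral_orb (T : X → X) (S : Finset X) (n : ℕ) (f : X → ℝ) :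
    ∫ x, f x ∂(orb T S n) = (∑ x ∈ S, ∑ i ∈ Finset.range n, f (T^[i + 1] x)) / (S.card * n) := by
  unfold orb
  rw [integral_emp, Fintype.sum_prod_type, ← Finset.sum_coe_sort S]
  simp [Finset.sum_range]

theorem orb_inv_bound (T : X → X) (S : Finset X) (hS : S.Nonempty) (n : ℕ) (hn : n ≠ 0)
    (f : X → ℝ) (C : ℝ) (hC : ∀ x, |f x| ≤ C) :
    |∫ x, f (T x) ∂(orb T S n) - ∫ x, f x ∂(orb T S n)| ≤ 2 * C / n := by
  rw [integral_orb, integral_orb, ← sub_div, ← Finset.sum_sub_distrib]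
  have hSc : (0 : ℝ) < S.card := by exact_mod_cast hS.card_pos
  have hn' : (0 : ℝ) < n := by exact_mod_cast Nat.pos_of_ne_zero hn
  rw [abs_div, abs_of_pos (mul_pos hSc hn'), div_le_div_iff₀ (mul_pos hSc hn') hn']
  have : ∀ x ∈ S, |∑ i ∈ Finset.range n, f (T (T^[i + 1] x)) -
      ∑ i ∈ Finset.range n, f (T^[i + 1] x)| ≤ 2 * C := by
    intro x _
    rw [← Finset.sum_sub_distrib]
    have : ∀ i, f (T (T^[i + 1] x)) = f (T^[i + 1 + 1] x) := by
      intro i; rw [Function.iterate_succ_apply' T (i+1)]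
    simp_rw [this]
    rw [Finset.sum_range_sub (fun i => f (T^[i + 1] x))]
    have h1 := hC (T^[n + 1] x)
    have h2 := hC (T^[0 + 1] x)
    rw [abs_le] at *
    constructor <;> linarith
  have h2 := (Finset.abs_sum_le_sum_abs _ _).trans (Finset.sum_le_sum this)
  rw [Finset.sum_const, nsmul_eq_mul] at h2
  nlinarith

theorem orb_map_eq (T : X → X) (S : Finset X) (n : ℕ) (hn : n ≠ 0) {q : ℕ}
    (Q : X → Fin q) (hQ : Measurable Q)
    (hty : ∀ x ∈ S, ∀ y ∈ S, ∀ l, (Finset.univ.filter fun i : Fin n => Q (T^[(i : ℕ) + 1] x) = l).card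
      = (Finset.univ.filter fun i : Fin n => Q (T^[(i : ℕ) + 1] y) = l).card) (x : X) (hx : x ∈ S) :
    (orb T S n).map Q = (emp (fun i : Fin n => T^[(i : ℕ) + 1] x)).map Q := by
  classical
  refine Measure.ext_of_singleton ?_
  intro l
  rw [Measure.map_apply hQ (measurableSet_singleton l),
    Measure.map_apply hQ (measurableSet_singleton l)]
  unfold orb
  rw [emp_apply _ (hQ (measurableSet_singleton l)), emp_apply _ (hQ (measurableSet_singleton l)),
    Fintype.sum_prod_type]
  have h : ∀ y, ∑ i : Fin n, (Q ⁻¹' {l}).indicator (1 : X → ℝ≥0∞) (T^[(i : ℕ) + 1] y) =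
    ((Finset.univ.filter fun i : Fin n => Q (T^[(i : ℕ) + 1] y) = l).card : ℝ≥0∞) := by
    intro y
    simp only [Set.indicator_apply, Set.mem_preimage, Set.mem_singleton_iff, Pi.one_apply]
    rw [Finset.sum_boole]
  simp_rw [h]
  have h2 : ∀ y : S, ((Finset.univ.filter fun i : Fin n => Q (T^[(i : ℕ) + 1] (y : X)) = l).card : ℝ≥0∞)
    = ((Finset.univ.filter fun i : Fin n => Q (T^[(i : ℕ) + 1] x) = l).card : ℝ≥0∞) := by
    intro y
    rw [hty y y.2 x hx l]
  simp_rw [h2]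
  simp only [Finset.sum_const, Fintype.card_prod, Fintype.card_fin, Fintype.card_coe,
    Finset.card_univ, nsmul_eq_mul, Nat.cast_mul]
  have hS : (S.card : ℝ≥0∞) ≠ 0 := by
    simpa using Finset.ne_empty_of_mem hx
  rw [ENNReal.mul_inv (Or.inl hS) (Or.inl (by simp)), mul_comm (S.card : ℝ≥0∞)⁻¹, mul_assoc,
    ← mul_assoc (S.card : ℝ≥0∞)⁻¹, ENNReal.inv_mul_cancel hS (by simp), one_mul]

/-- Existence of a limit measure in `Mset`. -/
theorem exists_limit {r : ℕ} (T : X → X) (hT : Continuous T) (Φ : (Fin r → X) → ℝ)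
    (hΦ : Continuous Φ) (α : ℝ) (n : ℕ → ℕ) (hn0 : ∀ j, n j ≠ 0) (hn : Tendsto n atTop atTop)
    (S : ℕ → Finset X) (hS : ∀ j, (S j).Nonempty)
    (hV : ∀ j, ∀ x ∈ S j, |Vstat T Φ (n j) x - α| ≤ 1 / ((j : ℝ) + 1))
    (hty : ∀ j : ℕ, ∃ (q : ℕ) (Q : X → Fin q), Measurable Q ∧
      (∀ x y, Q x = Q y → dist x y < 1 / ((j : ℝ) + 1)) ∧
      ∀ x ∈ S j, ∀ y ∈ S j, ∀ l, (Finset.univ.filter fun i : Fin (n j) => Q (T^[(i : ℕ) + 1] x) = l).card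
      = (Finset.univ.filter fun i : Fin (n j) => Q (T^[(i : ℕ) + 1] y) = l).card) :
    ∃ (U : Ultrafilter ℕ) (μ : ProbabilityMeasure X) (ν : ℕ → ProbabilityMeasure X),
      (U : Filter ℕ) ≤ atTop ∧ (μ : Measure X) ∈ Mset T Φ α ∧
      (∀ j, (ν j : Measure X) = orb T (S j) (n j)) ∧ Tendsto ν U (𝓝 μ) := by
  classical
  have hprob : ∀ j, IsProbabilityMeasure (orb T (S j) (n j)) := by
    intro j
    have : Nonempty (S j) := (hS j).to_subtype
    have : Nonempty (Fin (n j)) := ⟨⟨0, Nat.pos_of_ne_zero (hn0 j)⟩⟩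
    exact emp_isProb _
  let ν : ℕ → ProbabilityMeasure X := fun j => ⟨orb T (S j) (n j), hprob j⟩
  let U : Ultrafilter ℕ := Ultrafilter.of atTop
  have hU : (U : Filter ℕ) ≤ atTop := Ultrafilter.of_le _
  obtain ⟨μ, -, hμ⟩ := (isCompact_univ (X := ProbabilityMeasure X)).ultrafilter_le_nhds
    (U.map ν) (by simp)
  have hμ' : Tendsto ν U (𝓝 μ) := hμ
  refine ⟨U, μ, ν, hU, ⟨inferInstance, ?_, ?_⟩, fun _ => rfl, hμ'⟩
  · refine invariant_of_limit hT hμ' ?_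
    intro f
    obtain ⟨C, hC⟩ : ∃ C, ∀ x, |f x| ≤ C := ⟨‖f‖, fun x => f.norm_coe_le_norm x⟩
    refine squeeze_zero_norm (a := fun j => 2 * C / (n j : ℝ)) ?_ ?_
    · intro j
      rw [Real.norm_eq_abs]
      exact orb_inv_bound T (S j) (hS j) (n j) (hn0 j) f C hC
    · have : Tendsto (fun j => 2 * C / (n j : ℝ)) atTop (𝓝 0) :=
        tendsto_const_nhds.div_atTop (tendsto_natCast_atTop_atTop.comp hn)
      exact this.mono_left hU
  · have h1 := tendsto_integral_pi hΦ hμ'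
    refine tendsto_nhds_unique h1 ?_
    have : Tendsto (fun j => ∫ y, Φ y ∂(Measure.pi fun _ : Fin r => (ν j : Measure X))) atTop
        (𝓝 α) := by
      rw [Metric.tendsto_atTop]
      intro ε hε
      have huc := CompactSpace.uniformContinuous_of_continuous hΦ
      obtain ⟨δ, hδ, hδ'⟩ := Metric.uniformContinuous_iff.1 huc (ε / 8) (by positivity)
      obtain ⟨J, hJ⟩ := exists_nat_one_div_lt (lt_min hδ (show 0 < ε / 4 by positivity))
      refine ⟨J, fun j hj => ?_⟩
      have hJj : 1 / ((j : ℝ) + 1) < min δ (ε / 4) := lt_of_le_of_lt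
        (one_div_le_one_div_of_le (by positivity) (by gcongr)) hJ
      obtain ⟨q, Q, hQ, hd, ht⟩ := hty j
      obtain ⟨x, hx⟩ := hS j
      have hm := orb_map_eq T (S j) (n j) (hn0 j) Q hQ ht x hx
      have : Nonempty (Fin (n j)) := ⟨⟨0, Nat.pos_of_ne_zero (hn0 j)⟩⟩
      have := emp_isProb (fun i : Fin (n j) => T^[(i : ℕ) + 1] x)
      have := hprob j
      have h2 := same_type_integral hΦ (orb T (S j) (n j))
        (emp (fun i : Fin (n j) => T^[(i : ℕ) + 1] x)) Q hQ hm (ε / 8) (by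
          intro y y' hy
          have hdist : dist y y' < δ := by
            rw [dist_pi_lt_iff hδ]
            intro b
            exact (hd _ _ (hy b)).trans (hJj.trans_le (min_le_left _ _))
          have := hδ' hdist
          rw [Real.dist_eq] at this
          exact this.le)
      rw [← Vstat_eq T Φ (n j) (hn0 j) x] at h2
      have h3 := hV j x hx
      have h4 : 1 / ((j : ℝ) + 1) < ε / 4 := hJj.trans_le (min_le_right _ _)
      rw [Real.dist_eq]
      change |∫ y, Φ y ∂(Measure.pi fun _ : Fin r => orb T (S j) (n j)) - α| < ε
      rw [abs_le] at h2 h3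
      rw [abs_lt]
      constructor <;> linarith [h2.1, h2.2, h3.1, h3.2]
    exact this.mono_left hU

/-- finite measurable partitions with small cells and null boundary -/
theorem exists_small_partition (μ : Measure X) [IsFiniteMeasure μ] (δ : ℝ) (hδ : 0 < δ) :
    ∃ (q : ℕ) (Q : X → Fin q) (D : Set X), Measurable Q ∧ (∀ x y, Q x = Q y → dist x y < δ) ∧
      MeasurableSet D ∧ μ D = 0 ∧ ∀ x ∉ D, ∀ᶠ y in 𝓝 x, Q y = Q x := by
  classical
  have hrad : ∀ x : X, ∃ ρ ∈ Set.Ioo 0 (δ / 2), μ (frontier (Metric.ball x ρ)) = 0 := by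
    intro x
    obtain ⟨ρ, h1, h2⟩ := exists_null_frontier_thickening μ {x} (show 0 < δ / 2 by positivity)
    exact ⟨ρ, h1, by rwa [Metric.thickening_singleton] at h2⟩
  choose ρ hρ hρ0 using hrad
  obtain ⟨t, -, ht⟩ := (isCompact_univ (X := X)).elim_nhds_subcover (fun x => Metric.ball x (ρ x))
    (fun x _ => Metric.ball_mem_nhds x (hρ x).1)
  let c : Fin t.card → X := fun i => (t.equivFin.symm i : X)
  let B : Fin t.card → Set X := fun i => Metric.ball (c i) (ρ (c i))
  have hcov : ∀ x, ∃ i, x ∈ B i := by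
    intro x
    have := ht (Set.mem_univ x)
    simp only [Set.mem_iUnion] at this
    obtain ⟨y, hy, hxy⟩ := this
    refine ⟨t.equivFin ⟨y, hy⟩, ?_⟩
    simpa [B, c] using hxy
  have hmin : ∀ x, ∃ i, x ∈ B i ∧ ∀ j < i, x ∉ B j := by
    intro x
    obtain ⟨i, hi, hi2⟩ := WellFounded.has_min (wellFounded_lt (α := Fin t.card))
      {i | x ∈ B i} (hcov x)
    exact ⟨i, hi, fun j hj hx => hi2 j hx hj⟩
  choose Q hQ1 hQ2 using hmin
  have hQu : ∀ x i, x ∈ B i → (∀ j < i, x ∉ B j) → Q x = i := by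
    intro x i h1 h2
    rcases lt_trichotomy (Q x) i with h | h | h
    · exact absurd (hQ1 x) (h2 _ h)
    · exact h
    · exact absurd h1 (hQ2 x _ h)
  refine ⟨t.card, Q, ⋃ i, frontier (B i), ?_, ?_, ?_, ?_, ?_⟩
  · refine measurable_to_countable' ?_
    intro i
    have : Q ⁻¹' {i} = B i ∩ ⋂ j : Fin t.card, ⋂ _ : j < i, (B j)ᶜ := by
      ext x
      simp only [Set.mem_preimage, Set.mem_singleton_iff, Set.mem_inter_iff, Set.mem_iInter,
        Set.mem_compl_iff]
      constructor
      · rintro rfl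
        exact ⟨hQ1 x, hQ2 x⟩
      · rintro ⟨h1, h2⟩
        exact hQu x i h1 h2
    rw [this]
    refine (Metric.isOpen_ball.measurableSet).inter ?_
    refine MeasurableSet.iInter fun j => MeasurableSet.iInter fun _ => ?_
    exact Metric.isOpen_ball.measurableSet.compl
  · intro x y hxy
    have h1 : dist x (c (Q x)) < _ := hQ1 x
    have h2 : dist y (c (Q x)) < ρ (c (Q x)) := by have := hQ1 y; rw [← hxy] at this; exact this
    have h3 := (hρ (c (Q x))).2
    have := dist_triangle_right x y (c (Q x))
    linarith
  · exact MeasurableSet.iUnion fun i => isClosed_frontier.measurableSet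
  · rw [measure_iUnion_null_iff]
    intro i
    exact hρ0 _
  · intro x hx
    have h1 : ∀ i, ∀ᶠ y in 𝓝 x, (y ∈ B i ↔ x ∈ B i) := by
      intro i
      have hxi : x ∉ frontier (B i) := fun h => hx (Set.mem_iUnion.2 ⟨i, h⟩)
      by_cases hxB : x ∈ B i
      · filter_upwards [Metric.isOpen_ball.mem_nhds hxB] with y hy
        exact ⟨fun _ => hxB, fun _ => hy⟩
      · have : x ∉ closure (B i) := by
          intro hc
          apply hxi
          rw [frontier_eq_closure_inter_closure]
          exact ⟨hc, subset_closure hxB⟩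
        filter_upwards [isClosed_closure.isOpen_compl.mem_nhds this] with y hy
        exact ⟨fun h => absurd (subset_closure h) hy, fun h => absurd h hxB⟩
    filter_upwards [Filter.eventually_all.2 h1] with y hy
    apply hQu
    · exact (hy _).2 (hQ1 x)
    · intro j hj h
      exact hQ2 x j hj ((hy j).1 h)

end Lim


section FEnt
variable {X : Type*}

open Classical in
/-- frequency of a value of `g` on the finite set `S` -/
noncomputable def freq {ι : Type*} (S : Finset X) (g : X → ι) (i : ι) : ℝ :=
  ((S.filter fun x => g x = i).card : ℝ) / S.card

/-- entropy of `g` with respect to the uniform measure on the finite set `S` -/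
noncomputable def fent {ι : Type*} [Fintype ι] (S : Finset X) (g : X → ι) : ℝ :=
  ∑ i, Real.negMulLog (freq S g i)

theorem freq_nonneg {ι : Type*} (S : Finset X) (g : X → ι) (i : ι) : 0 ≤ freq S g i := by
  unfold freq; positivity

theorem freq_le_one {ι : Type*} (S : Finset X) (g : X → ι) (i : ι) : freq S g i ≤ 1 := by
  classical
  unfold freq
  apply div_le_one_of_le₀
  · exact_mod_cast Finset.card_filter_le _ _
  · positivity

theorem freq_sum {ι : Type*} [Fintype ι] (S : Finset X) (hS : S.Nonempty) (g : X → ι) :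
    ∑ i, freq S g i = 1 := by
  classical
  unfold freq
  rw [← Finset.sum_div]
  have : (S.card : ℝ) = ∑ i, ((S.filter fun x => g x = i).card : ℝ) := by
    rw [← Nat.cast_sum]
    rw [Finset.card_eq_sum_card_fiberwise (f := g) (t := Finset.univ) (by simp)]
  rw [← this]
  have : (S.card : ℝ) ≠ 0 := by exact_mod_cast hS.card_ne_zero
  exact div_self this

theorem freq_eq_sum {ι κ : Type*} [Fintype κ] [DecidableEq ι] (S : Finset X) (g : X → ι) (h : X → κ)
    (φ : κ → ι) (hφ : ∀ x ∈ S, g x = φ (h x)) (i : ι) :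
    freq S g i = ∑ j with φ j = i, freq S h j := by
  classical
  unfold freq
  rw [← Finset.sum_div]
  congr 1
  rw [← Nat.cast_sum]
  congr 1
  rw [Finset.card_eq_sum_card_fiberwise (f := h) (t := Finset.univ.filter fun j => φ j = i)]
  · refine Finset.sum_congr rfl ?_
    intro j hj
    congr 1
    ext x
    simp only [Finset.mem_filter, Finset.mem_univ, true_and] at *
    constructor
    · rintro ⟨⟨h1, h2⟩, h3⟩; exact ⟨h1, h3⟩
    · rintro ⟨h1, h3⟩
      refine ⟨⟨h1, ?_⟩, h3⟩
      rw [hφ x h1, h3, hj]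
  · intro x hx
    simp at hx ⊢
    rw [← hφ x hx.1, hx.2]

theorem fent_nonneg {ι : Type*} [Fintype ι] (S : Finset X) (g : X → ι) : 0 ≤ fent S g :=
  Finset.sum_nonneg fun i _ => Real.negMulLog_nonneg (freq_nonneg _ _ _) (freq_le_one _ _ _)

theorem negMulLog_le_one' {x : ℝ} (h : 0 ≤ x) : Real.negMulLog x ≤ 1 := by
  rcases h.eq_or_lt with rfl | h
  · simp
  · have := Real.one_sub_inv_le_log_of_pos h
    unfold Real.negMulLog
    have h2 : x * (1 - x⁻¹) ≤ x * Real.log x := mul_le_mul_of_nonneg_left this h.le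
    have h3 : x * (1 - x⁻¹) = x - 1 := by field_simp
    nlinarith

theorem fent_le_card {ι : Type*} [Fintype ι] (S : Finset X) (g : X → ι) :
    fent S g ≤ Fintype.card ι := by
  unfold fent
  calc _ ≤ ∑ i : ι, (1 : ℝ) := Finset.sum_le_sum fun i _ => negMulLog_le_one' (freq_nonneg _ _ _)
    _ = _ := by simp

theorem fent_mono {ι κ : Type*} [Fintype ι] [Fintype κ] (S : Finset X) (g : X → ι) (h : X → κ)
    (hdet : ∀ x ∈ S, ∀ y ∈ S, h x = h y → g x = g y) : fent S g ≤ fent S h := by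
  classical
  rcases S.eq_empty_or_nonempty with rfl | hS
  · simp [fent, freq]
  obtain ⟨x0, hx0⟩ := hS
  let φ : κ → ι := fun j => if hj : ∃ x ∈ S, h x = j then g hj.choose else g x0
  have hφ : ∀ x ∈ S, g x = φ (h x) := by
    intro x hx
    have hj : ∃ y ∈ S, h y = h x := ⟨x, hx, rfl⟩
    simp only [φ, dif_pos hj]
    exact hdet x hx _ hj.choose_spec.1 hj.choose_spec.2.symm
  unfold fent
  rw [← Finset.sum_fiberwise (s := Finset.univ) (g := φ)]
  refine Finset.sum_le_sum fun i _ => ?_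
  have hq := freq_eq_sum S g h φ hφ i
  have : Real.negMulLog (freq S g i) = ∑ j with φ j = i, -(freq S h j) * Real.log (freq S g i) := by
    rw [← Finset.sum_mul, Finset.sum_neg_distrib, ← hq]; rfl
  rw [this]
  refine Finset.sum_le_sum fun j hj => ?_
  unfold Real.negMulLog
  rcases (freq_nonneg S h j).eq_or_lt with h0 | h0
  · rw [← h0]; simp
  · have hle : freq S h j ≤ freq S g i := by
      rw [hq]
      exact Finset.single_le_sum (f := fun j => freq S h j) (fun j _ => freq_nonneg S h j) hj
    have := Real.log_le_log h0 hle
    nlinarith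

theorem fent_pair {ι κ : Type*} [Fintype ι] [Fintype κ] (S : Finset X) (g : X → ι) (h : X → κ) :
    fent S (fun x => (g x, h x)) ≤ fent S g + fent S h := by
  classical
  rcases S.eq_empty_or_nonempty with rfl | hS
  · simp [fent, freq]
  set p := freq S (fun x => (g x, h x)) with hp
  have hp0 : ∀ z, 0 ≤ p z := fun z => freq_nonneg _ _ _
  have hm1 : ∀ i, freq S g i = ∑ j, p (i, j) := by
    intro i
    rw [freq_eq_sum S g (fun x => (g x, h x)) Prod.fst (fun _ _ => rfl) i]
    rw [Finset.sum_filter, Fintype.sum_prod_type]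
    rw [Finset.sum_eq_single i]
    · simp [hp]
    · intro b _ hb; simp [hb]
    · simp
  have hm2 : ∀ j, freq S h j = ∑ i, p (i, j) := by
    intro j
    rw [freq_eq_sum S h (fun x => (g x, h x)) Prod.snd (fun _ _ => rfl) j]
    rw [Finset.sum_filter, Fintype.sum_prod_type]
    refine Finset.sum_congr rfl fun i _ => ?_
    simp [hp]
  have hpt : ∀ i j, Real.negMulLog (p (i, j)) ≤ -(p (i, j) * Real.log (freq S g i))
      - p (i, j) * Real.log (freq S h j) + freq S g i * freq S h j - p (i, j) := by
    intro i j
    have ha : p (i, j) ≤ freq S g i := by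
      rw [hm1]; exact Finset.single_le_sum (f := fun j => p (i, j)) (fun j _ => hp0 _) (Finset.mem_univ j)
    have hb : p (i, j) ≤ freq S h j := by
      rw [hm2]; exact Finset.single_le_sum (f := fun i => p (i, j)) (fun j _ => hp0 _) (Finset.mem_univ i)
    rcases (hp0 (i, j)).eq_or_lt with h0 | h0
    · rw [← h0]; simp
      exact mul_nonneg (freq_nonneg _ _ _) (freq_nonneg _ _ _)
    · have ha' := h0.trans_le ha
      have hb' := h0.trans_le hb
      have hl := Real.log_le_sub_one_of_pos (show 0 < freq S g i * freq S h j / p (i, j) by positivity)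
      rw [Real.log_div (by positivity) h0.ne', Real.log_mul ha'.ne' hb'.ne'] at hl
      have := mul_le_mul_of_nonneg_left hl h0.le
      have h3 : p (i, j) * (freq S g i * freq S h j / p (i, j) - 1) =
        freq S g i * freq S h j - p (i, j) := by field_simp
      unfold Real.negMulLog
      nlinarith
  have hsum : fent S (fun x => (g x, h x)) ≤ ∑ i, ∑ j, (-(p (i, j) * Real.log (freq S g i))
      - p (i, j) * Real.log (freq S h j) + freq S g i * freq S h j - p (i, j)) := by
    unfold fent
    rw [Fintype.sum_prod_type]
    exact Finset.sum_le_sum fun i _ => Finset.sum_le_sum fun j _ => hpt i j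
  refine hsum.trans (le_of_eq ?_)
  simp only [Finset.sum_add_distrib, Finset.sum_sub_distrib, Finset.sum_neg_distrib]
  have e1 : ∑ i, ∑ j, p (i, j) * Real.log (freq S g i) = - fent S g := by
    simp_rw [← Finset.sum_mul, ← hm1]
    simp [fent, Real.negMulLog]
  have e2 : ∑ i, ∑ j, p (i, j) * Real.log (freq S h j) = - fent S h := by
    rw [Finset.sum_comm]
    simp_rw [← Finset.sum_mul, ← hm2]
    simp [fent, Real.negMulLog]
  have e3 : ∑ i, ∑ j, freq S g i * freq S h j = 1 := by
    simp_rw [← Finset.mul_sum]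
    rw [freq_sum S hS h]; simp [freq_sum S hS g]
  have e4 : ∑ i, ∑ j, p (i, j) = 1 := by
    simp_rw [← hm1]; exact freq_sum S hS g
  rw [e1, e2, e3, e4]; ring

theorem fent_sub {ι κ θ : Type*} [Fintype ι] [Fintype κ] [Fintype θ] (S : Finset X)
    (f : X → θ) (g : X → ι) (h : X → κ)
    (hdet : ∀ x ∈ S, ∀ y ∈ S, g x = g y → h x = h y → f x = f y) :
    fent S f ≤ fent S g + fent S h := by
  refine (fent_mono S f (fun x => (g x, h x)) ?_).trans (fent_pair S g h)
  intro x hx y hy hxy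
  exact hdet x hx y hy (Prod.ext_iff.1 hxy).1 (Prod.ext_iff.1 hxy).2

theorem fent_inj {ι : Type*} [Fintype ι] (S : Finset X) (g : X → ι)
    (hinj : ∀ x ∈ S, ∀ y ∈ S, g x = g y → x = y) : Real.log S.card ≤ fent S g := by
  classical
  rcases S.eq_empty_or_nonempty with rfl | hS
  · simp [fent, freq]
  have hc : (0 : ℝ) < S.card := by exact_mod_cast hS.card_pos
  have h1 : ∀ i, freq S g i * Real.log S.card ≤ Real.negMulLog (freq S g i) := by
    intro i
    have hle : freq S g i ≤ (S.card : ℝ)⁻¹ := by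
      unfold freq
      rw [inv_eq_one_div]
      gcongr
      have : (S.filter fun x => g x = i).card ≤ 1 := by
        rw [Finset.card_le_one]
        intro a ha b hb
        simp at ha hb
        exact hinj a ha.1 b hb.1 (ha.2.trans hb.2.symm)
      exact_mod_cast this
    rcases (freq_nonneg S g i).eq_or_lt with h0 | h0
    · rw [← h0]; simp
    · have := Real.log_le_log h0 hle
      rw [Real.log_inv] at this
      unfold Real.negMulLog
      nlinarith
  calc Real.log S.card = ∑ i, freq S g i * Real.log S.card := by
        rw [← Finset.sum_mul, freq_sum S hS g, one_mul]
    _ ≤ _ := Finset.sum_le_sum fun i _ => h1 i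

end FEnt

section Mis
variable {X : Type*}

/-- the `P`-name of length `n` -/
def nm (T : X → X) {k : ℕ} (P : X → Fin k) (n : ℕ) (x : X) : Fin n → Fin k :=
  fun j => P (T^[(j : ℕ)] x)

theorem nm_eq_iff (T : X → X) {k : ℕ} (P : X → Fin k) (n : ℕ) (x y : X) :
    nm T P n x = nm T P n y ↔ ∀ j < n, P (T^[j] x) = P (T^[j] y) := by
  constructor
  · intro h j hj
    exact congrFun h ⟨j, hj⟩
  · intro h
    funext j
    exact h j j.2

theorem mis_chain (T : X → X) {k : ℕ} (P : X → Fin k) (S : Finset X) (q a τ : ℕ) :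
    fent S (nm T P (a + τ * q)) ≤ fent S (nm T P a) +
      ∑ t ∈ Finset.range τ, fent S (fun x => nm T P q (T^[a + t * q] x)) := by
  induction τ with
  | zero =>
    simp only [Finset.range_zero, Finset.sum_empty, add_zero]
    apply fent_mono
    intro x _ y _ h
    rw [nm_eq_iff] at *
    intro j hj
    exact h j (by simpa using hj)
  | succ τ ih =>
    rw [Finset.sum_range_succ, ← add_assoc]
    refine le_trans (fent_sub S _ (nm T P (a + τ * q))
      (fun x => nm T P q (T^[a + τ * q] x)) ?_) (by gcongr)
    intro x _ y _ h1 h2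
    rw [nm_eq_iff] at *
    intro j hj
    by_cases hja : j < a + τ * q
    · exact h1 j hja
    · have := h2 (j - (a + τ * q)) (by rw [add_mul] at hj; omega)
      rw [← Function.iterate_add_apply, ← Function.iterate_add_apply,
        Nat.sub_add_cancel (not_lt.1 hja)] at this
      exact this

theorem sum_range_mul' (h : ℕ → ℝ) (q τ : ℕ) :
    ∑ a ∈ Finset.range q, ∑ t ∈ Finset.range τ, h (a + t * q) = ∑ b ∈ Finset.range (τ * q), h b := by
  induction τ with
  | zero => simp
  | succ τ ih =>
    simp_rw [Finset.sum_range_succ]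
    rw [Finset.sum_add_distrib, ih, add_mul, one_mul, Finset.sum_range_add]
    congr 1
    exact Finset.sum_congr rfl fun i _ => by rw [add_comm]

theorem mis_sum (T : X → X) {k : ℕ} (P : X → Fin k) (S : Finset X) (q n : ℕ) (hq : 0 < q) :
    q * fent S (nm T P n) ≤ 2 * q * (k : ℝ) ^ q +
      ∑ b ∈ Finset.range n, fent S (fun x => nm T P q (T^[b + 1] x)) := by
  set τ := n / q + 1 with hτ
  have hτ1 : n < τ * q := by
    rw [hτ, add_mul, one_mul, mul_comm]
    have := Nat.div_add_mod n q
    have := Nat.mod_lt n hq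
    omega
  have hτ2 : τ * q ≤ n + q := by
    rw [hτ, add_mul, one_mul]; have := Nat.div_mul_le_self n q; omega
  set h : ℕ → ℝ := fun b => fent S (fun x => nm T P q (T^[b + 1] x)) with hh
  have hC : ∀ b, h b ≤ (k : ℝ) ^ q := by
    intro b
    refine (fent_le_card _ _).trans (by simp)
  have h1 : ∀ a ∈ Finset.range q, fent S (nm T P n) ≤ (k : ℝ) ^ q + ∑ t ∈ Finset.range τ, h (a + t * q) := by
    intro a ha
    have ha' : a < q := by simpa using ha
    have e1 := mis_chain T P S q (a + 1) τ
    have e2 : fent S (nm T P n) ≤ fent S (nm T P (a + 1 + τ * q)) := by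
      apply fent_mono
      intro x _ y _ hxy
      rw [nm_eq_iff] at *
      intro j hj
      exact hxy j (by omega)
    have e3 : fent S (nm T P (a + 1)) ≤ (k : ℝ) ^ q := by
      refine le_trans (fent_mono S _ (nm T P q) ?_) ((fent_le_card _ _).trans (by simp))
      intro x _ y _ hxy
      rw [nm_eq_iff] at *
      intro j hj
      exact hxy j (by omega)
    refine e2.trans (e1.trans ?_)
    gcongr with t ht
    rw [hh]
    apply le_of_eq
    simp only [show a + 1 + t * q = a + t * q + 1 by ring]
  have h2 := Finset.sum_le_sum h1
  rw [Finset.sum_const, Finset.sum_add_distrib, Finset.sum_const, sum_range_mul', Finset.card_range,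
    nsmul_eq_mul, nsmul_eq_mul] at h2
  have h3 : ∑ b ∈ Finset.range (τ * q), h b ≤ ∑ b ∈ Finset.range n, h b + q * (k : ℝ) ^ q := by
    calc _ ≤ ∑ b ∈ Finset.range (n + q), h b := by
          apply Finset.sum_le_sum_of_subset_of_nonneg
          · intro x; simp; omega
          · intro i _ _; exact fent_nonneg _ _
      _ = _ := Finset.sum_range_add _ _ _
      _ ≤ _ := by
        gcongr
        calc _ ≤ ∑ i ∈ Finset.range q, (k : ℝ) ^ q := Finset.sum_le_sum fun i _ => hC _
          _ = _ := by simp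
  linarith

variable [MetricSpace X] [CompactSpace X] [MeasurableSpace X] [BorelSpace X]

theorem nm_measurable {T : X → X} (hT : Continuous T) {k : ℕ} {P : X → Fin k} (hP : Measurable P)
    (n : ℕ) : Measurable (nm T P n) := by
  refine measurable_pi_lambda _ fun j => ?_
  exact hP.comp (hT.iterate _).measurable

theorem orb_real {T : X → X} (S : Finset X) (n : ℕ) {ι : Type*} [MeasurableSpace ι]
    [MeasurableSingletonClass ι] (g : X → ι) (hg : Measurable g) (i : ι) :
    (orb T S n (g ⁻¹' {i})).toReal =
      ∑ b ∈ Finset.range n, (1 / (n : ℝ)) * freq S (fun x => g (T^[b + 1] x)) i := by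
  classical
  have hm : MeasurableSet (g ⁻¹' {i}) := hg (measurableSet_singleton i)
  have h1 : (orb T S n (g ⁻¹' {i})).toReal = ∫ x, (g ⁻¹' {i}).indicator 1 x ∂(orb T S n) := by
    rw [integral_indicator_one hm]; rfl
  rw [h1, integral_orb, Finset.sum_comm, Finset.sum_div]
  refine Finset.sum_congr rfl fun b _ => ?_
  unfold freq
  have : ∑ x ∈ S, (g ⁻¹' {i}).indicator (1 : X → ℝ) (T^[b + 1] x) =
    ((S.filter fun x => g (T^[b + 1] x) = i).card : ℝ) := by
    simp only [Set.indicator_apply, Set.mem_preimage, Set.mem_singleton_iff, Pi.one_apply]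
    rw [Finset.sum_boole]
  rw [this, mul_comm (S.card : ℝ), ← div_div, div_right_comm, one_div, inv_mul_eq_div]

theorem misiurewicz {T : X → X} (hT : Continuous T) {k : ℕ} {P : X → Fin k} (hP : Measurable P)
    (S : Finset X) (q n : ℕ) (hq : 0 < q) (hn : 0 < n)
    (hsep : ∀ x ∈ S, ∀ y ∈ S, nm T P n x = nm T P n y → x = y) :
    q * Real.log S.card ≤ 2 * q * (k : ℝ) ^ q + n * partEntropy (orb T S n) (nm T P q) := by
  have h1 := mis_sum T P S q n hq
  have h2 := fent_inj S (nm T P n) hsep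
  have h3 : ∑ b ∈ Finset.range n, fent S (fun x => nm T P q (T^[b + 1] x)) ≤
      n * partEntropy (orb T S n) (nm T P q) := by
    unfold partEntropy fent
    rw [Finset.sum_comm, Finset.mul_sum]
    refine Finset.sum_le_sum fun w _ => ?_
    rw [orb_real S n _ (nm_measurable hT hP q)]
    have hn' : (0 : ℝ) < n := by exact_mod_cast hn
    have := Real.concaveOn_negMulLog.le_map_sum (t := Finset.range n) (w := fun _ => 1 / (n : ℝ))
      (p := fun b => freq S (fun x => nm T P q (T^[b + 1] x)) w) (fun _ _ => by positivity)
      (by simp; field_simp) (fun b _ => freq_nonneg _ _ _)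
    simp only [smul_eq_mul] at this
    rw [← Finset.mul_sum] at this
    rw [one_div, inv_mul_le_iff₀ hn'] at this
    simpa [one_div] using this
  have : (q : ℝ) * Real.log S.card ≤ q * fent S (nm T P n) := by gcongr
  linarith

end Mis


section Upper
variable {X : Type*} [MetricSpace X]

theorem bowenHn_le {T : X → X} {Z : Set X} {s ε : ℝ} {n : ℕ} (c : ℕ → X × ℕ)
    (h1 : Z ⊆ ⋃ i, bowenBall T (c i).2 ε (c i).1) (h2 : ∀ i, n ≤ (c i).2) :
    bowenHn T Z s ε n ≤ ∑' i, ENNReal.ofReal (Real.exp (-(s * ((c i).2 : ℝ)))) := by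
  unfold bowenHn
  exact iInf_le_of_le c (iInf_le_of_le h1 (iInf_le _ h2))

theorem bowenHn_le_of_finite_cover (T : X → X) (Z : Set X) (s ε : ℝ) (hs : 0 < s) (n : ℕ)
    [Nonempty X] (S : Finset X) (hS : ∀ z ∈ Z, ∃ x ∈ S, z ∈ bowenBall T n ε x) :
    bowenHn T Z s ε n ≤ S.card * ENNReal.ofReal (Real.exp (-(s * n))) := by
  classical
  refine ENNReal.le_of_forall_pos_le_add ?_
  intro η hη _
  obtain ⟨δ, hδ0, hδ⟩ := ENNReal.exists_pos_sum_of_countable' (ε := (η : ℝ≥0∞))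
    (by simpa using hη.ne') ℕ
  have hN : ∀ i, ∃ N, n ≤ N ∧ ENNReal.ofReal (Real.exp (-(s * (N : ℝ)))) ≤ δ i := by
    intro i
    have h1 : Tendsto (fun N : ℕ => ENNReal.ofReal (Real.exp (-(s * (N : ℝ))))) atTop (𝓝 0) := by
      have : Tendsto (fun N : ℕ => Real.exp (-(s * (N : ℝ)))) atTop (𝓝 0) := by
        refine Real.tendsto_exp_atBot.comp ?_
        refine tendsto_neg_atTop_atBot.comp ?_
        exact Tendsto.const_mul_atTop hs tendsto_natCast_atTop_atTop
      simpa using ENNReal.tendsto_ofReal this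
    obtain ⟨N, h2, h3⟩ := ((eventually_ge_atTop n).and
      (h1.eventually (gt_mem_nhds (hδ0 i)))).exists
    exact ⟨N, h2, h3.le⟩
  choose N hN1 hN2 using hN
  let c : ℕ → X × ℕ := fun i => if h : i < S.card then ((S.equivFin.symm ⟨i, h⟩ : X), n)
    else (Classical.arbitrary X, N i)
  have hc1 : Z ⊆ ⋃ i, bowenBall T (c i).2 ε (c i).1 := by
    intro z hz
    obtain ⟨x, hx, hzx⟩ := hS z hz
    refine Set.mem_iUnion.2 ⟨S.equivFin ⟨x, hx⟩, ?_⟩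
    have hlt : ((S.equivFin ⟨x, hx⟩ : Fin S.card) : ℕ) < S.card := Fin.is_lt _
    simpa [c, dif_pos hlt] using hzx
  have hc2 : ∀ i, n ≤ (c i).2 := by
    intro i
    by_cases h : i < S.card
    · simp [c, dif_pos h]
    · simp [c, dif_neg h, hN1]
  refine (bowenHn_le c hc1 hc2).trans ?_
  have hterm : ∀ i, ENNReal.ofReal (Real.exp (-(s * ((c i).2 : ℝ)))) ≤
      (if i ∈ Finset.range S.card then ENNReal.ofReal (Real.exp (-(s * n))) else 0) + δ i := by
    intro i
    by_cases h : i < S.card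
    · simp [c, dif_pos h, h]
    · simp only [c, dif_neg h, Finset.mem_range, h, if_false, zero_add]
      exact hN2 i
  refine (ENNReal.tsum_le_tsum hterm).trans ?_
  rw [ENNReal.tsum_add]
  gcongr
  rw [tsum_eq_sum (s := Finset.range S.card)]
  · rw [Finset.sum_congr rfl (fun i hi => if_pos hi)]
    simp
  · intro i hi
    simp only [if_neg hi]

theorem bowenHn_iUnion_zero (T : X → X) (Z : ℕ → Set X) (s ε : ℝ) (n : ℕ)
    (h : ∀ N, bowenHn T (Z N) s ε n = 0) : bowenHn T (⋃ N, Z N) s ε n = 0 := by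
  refine le_antisymm ?_ zero_le
  refine ENNReal.le_of_forall_pos_le_add ?_
  intro η hη _
  obtain ⟨δ, hδ0, hδ⟩ := ENNReal.exists_pos_sum_of_countable' (ε := (η : ℝ≥0∞))
    (by simpa using hη.ne') ℕ
  have hN : ∀ N, ∃ c : ℕ → X × ℕ, Z N ⊆ (⋃ i, bowenBall T (c i).2 ε (c i).1) ∧
      (∀ i, n ≤ (c i).2) ∧ ∑' i, ENNReal.ofReal (Real.exp (-(s * ((c i).2 : ℝ)))) < δ N := by
    intro N
    have : bowenHn T (Z N) s ε n < δ N := by rw [h]; exact hδ0 N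
    unfold bowenHn at this
    simp only [iInf_lt_iff] at this
    obtain ⟨c, h1, h2, h3⟩ := this
    exact ⟨c, h1, h2, h3⟩
  choose c h1 h2 h3 using hN
  let d : ℕ → X × ℕ := fun i => c (Nat.unpair i).1 (Nat.unpair i).2
  have hd1 : (⋃ N, Z N) ⊆ ⋃ i, bowenBall T (d i).2 ε (d i).1 := by
    intro z hz
    obtain ⟨N, hz⟩ := Set.mem_iUnion.1 hz
    obtain ⟨i, hi⟩ := Set.mem_iUnion.1 (h1 N hz)
    refine Set.mem_iUnion.2 ⟨Nat.pair N i, ?_⟩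
    simpa [d] using hi
  have hd2 : ∀ i, n ≤ (d i).2 := fun i => h2 _ _
  refine (bowenHn_le d hd1 hd2).trans ?_
  rw [zero_add]
  refine le_trans ?_ hδ.le
  rw [← Nat.pairEquiv.tsum_eq]
  rw [ENNReal.tsum_prod']
  refine ENNReal.tsum_le_tsum fun N => ?_
  simpa [d] using (h3 N).le

/-- existence of large separated sets -/
theorem exists_separated (T : X → X) (Z : Set X) (s ε : ℝ) (hs : 0 < s) (hε : 0 < ε)
    [Nonempty X] (n0 : ℕ) (h0 : bowenHn T Z s ε n0 ≠ 0) :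
    ∃ c : ℝ, 0 < c ∧ ∀ n ≥ n0, ∃ S : Finset X, (∀ x ∈ S, x ∈ Z) ∧
      (∀ x ∈ S, ∀ y ∈ S, y ∈ bowenBall T n ε x → x = y) ∧ c * Real.exp (s * n) ≤ S.card := by
  classical
  obtain ⟨c, hc0, hc⟩ := ENNReal.lt_iff_exists_nnreal_btwn.1 (pos_iff_ne_zero.2 h0)
  have hc0' : (0 : ℝ) < c := by exact_mod_cast hc0
  refine ⟨c, hc0', fun n hn => ?_⟩
  by_contra hcon
  push Not at hcon
  have hex : ∃ S : Finset X, ((∀ x ∈ S, x ∈ Z) ∧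
      (∀ x ∈ S, ∀ y ∈ S, y ∈ bowenBall T n ε x → x = y)) ∧
      ∀ S' : Finset X, ((∀ x ∈ S', x ∈ Z) ∧
      (∀ x ∈ S', ∀ y ∈ S', y ∈ bowenBall T n ε x → x = y)) → S'.card ≤ S.card := by
    let A : Set ℕ := {m | ∃ S : Finset X, ((∀ x ∈ S, x ∈ Z) ∧
      (∀ x ∈ S, ∀ y ∈ S, y ∈ bowenBall T n ε x → x = y)) ∧ S.card = m}
    have hA : A.Nonempty := ⟨0, ∅, by simp, by simp⟩
    have hB : BddAbove A := by
      refine ⟨⌈(c : ℝ) * Real.exp (s * n)⌉₊, ?_⟩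
      rintro m ⟨S, ⟨h1, h2⟩, rfl⟩
      have := hcon S h1 h2
      exact_mod_cast (this.le.trans (Nat.le_ceil _))
    obtain ⟨S, h1, h2⟩ := Nat.sSup_mem hA hB
    refine ⟨S, h1, fun S' h' => ?_⟩
    rw [h2]
    exact le_csSup hB ⟨S', h', rfl⟩
  obtain ⟨S, ⟨h1, h2⟩, hmax⟩ := hex
  have hcov : ∀ z ∈ Z, ∃ x ∈ S, z ∈ bowenBall T n ε x := by
    intro z hz
    by_contra hno
    push Not at hno
    have hself : ∀ x, x ∈ bowenBall T n ε x := fun x j _ => by simpa using hε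
    have hzS : z ∉ S := fun h => hno z h (hself z)
    have := hmax (insert z S) ⟨?_, ?_⟩
    · rw [Finset.card_insert_of_notMem hzS] at this; omega
    · intro x hx
      rcases Finset.mem_insert.1 hx with rfl | hx
      · exact hz
      · exact h1 x hx
    · intro x hx y hy hxy
      rcases Finset.mem_insert.1 hx with h | hx <;> rcases Finset.mem_insert.1 hy with h' | hy
      · rw [h, h']
      · exfalso
        apply hno y hy
        intro j hj
        rw [dist_comm, ← h]; exact hxy j hj
      · exfalso
        apply hno x hx
        rw [← h']; exact hxy
      · exact h2 x hx y hy hxy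
  have hb := bowenHn_le_of_finite_cover T Z s ε hs n S hcov
  have hmono : bowenHn T Z s ε n0 ≤ bowenHn T Z s ε n := by
    unfold bowenHn
    refine le_iInf fun c => le_iInf fun h1 => le_iInf fun h2 => ?_
    exact iInf_le_of_le c (iInf_le_of_le h1 (iInf_le _ fun i => hn.trans (h2 i)))
  have hlt := hcon S h1 h2
  have : (S.card : ℝ≥0∞) * ENNReal.ofReal (Real.exp (-(s * n))) ≤ c := by
    rw [show (S.card : ℝ≥0∞) = ENNReal.ofReal (S.card : ℝ) by simp, ← ENNReal.ofReal_mul (by positivity)]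
    rw [show (c : ℝ≥0∞) = ENNReal.ofReal (c : ℝ) by simp]
    apply ENNReal.ofReal_le_ofReal
    rw [Real.exp_neg, ← div_eq_mul_inv, div_le_iff₀ (Real.exp_pos _)]
    exact hlt.le
  exact absurd (hc.trans_le (hmono.trans (hb.trans this))) (lt_irrefl _)

variable [CompactSpace X] [MeasurableSpace X] [BorelSpace X]

theorem limit_entropy {T : X → X} (hT : Continuous T) (ε s : ℝ) (hε : 0 < ε)
    (U : Ultrafilter ℕ) (hU : (U : Filter ℕ) ≤ atTop) (μ : ProbabilityMeasure X)
    (hinv : MeasurePreserving T (μ : Measure X) (μ : Measure X))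
    (ν : ℕ → ProbabilityMeasure X) (hlim : Tendsto ν U (𝓝 μ))
    (S : ℕ → Finset X) (n : ℕ → ℕ) (hn0 : ∀ j, n j ≠ 0) (hn : Tendsto n atTop atTop)
    (hν : ∀ j, (ν j : Measure X) = orb T (S j) (n j))
    (hsep : ∀ j, ∀ x ∈ S j, ∀ y ∈ S j, y ∈ bowenBall T (n j) ε x → x = y)
    (hcard : ∀ j, Real.exp (s * n j) ≤ (S j).card) :
    ENNReal.ofReal s ≤ hKS T (μ : Measure X) := by
  classical
  obtain ⟨k, P, D, hP, hPd, hDm, hD0, hDl⟩ := exists_small_partition (μ : Measure X) ε hε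
  have key : ∀ q : ℕ, 0 < q → q * s ≤ partEntropy (μ : Measure X) (nm T P q) := by
    intro q hq
    have hcell : ∀ w, Tendsto (fun j => ((ν j : Measure X) ((nm T P q) ⁻¹' {w})).toReal) U
        (𝓝 ((μ : Measure X) ((nm T P q) ⁻¹' {w})).toReal) := by
      intro w
      refine (ENNReal.continuousAt_toReal (measure_ne_top _ _)).tendsto.comp ?_
      refine ProbabilityMeasure.tendsto_measure_of_null_frontier_of_tendsto' hlim ?_
      have hsub : frontier ((nm T P q) ⁻¹' {w}) ⊆ ⋃ j : Fin q, (T^[(j : ℕ)]) ⁻¹' D := by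
        intro x hx
        by_contra hno
        simp only [Set.mem_iUnion, Set.mem_preimage, not_exists] at hno
        have h1 : ∀ j : Fin q, ∀ᶠ y in 𝓝 x, P (T^[(j : ℕ)] y) = P (T^[(j : ℕ)] x) := by
          intro j
          exact ((hT.iterate j).tendsto x).eventually (hDl _ (hno j))
        have h2 : ∀ᶠ y in 𝓝 x, nm T P q y = nm T P q x := by
          filter_upwards [Filter.eventually_all.2 h1] with y hy
          funext j
          exact hy j
        rw [frontier_eq_closure_inter_closure] at hx
        obtain ⟨ha, hb⟩ := hx
        rw [mem_closure_iff_frequently] at ha hb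
        obtain ⟨y, hy1, hy2⟩ := (ha.and_eventually h2).exists
        obtain ⟨z, hz1, hz2⟩ := (hb.and_eventually h2).exists
        apply hz1
        simp only [Set.mem_preimage, Set.mem_singleton_iff] at *
        rw [hz2, ← hy2, hy1]
      refine measure_mono_null hsub ?_
      rw [measure_iUnion_null_iff]
      intro j
      rw [(hinv.iterate j).measure_preimage hDm.nullMeasurableSet, hD0]
    have hent : Tendsto (fun j => partEntropy (ν j : Measure X) (nm T P q)) U
        (𝓝 (partEntropy (μ : Measure X) (nm T P q))) := by
      unfold partEntropy
      refine tendsto_finsetSum _ fun w _ => ?_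
      exact (Real.continuous_negMulLog.tendsto _).comp (hcell w)
    have hlow : Tendsto (fun j => q * s - 2 * q * (k : ℝ) ^ q / n j) U (𝓝 (q * s)) := by
      have : Tendsto (fun j => q * s - 2 * q * (k : ℝ) ^ q / n j) atTop (𝓝 (q * s - 0)) :=
        tendsto_const_nhds.sub (tendsto_const_nhds.div_atTop (tendsto_natCast_atTop_atTop.comp hn))
      rw [sub_zero] at this
      exact this.mono_left hU
    refine le_of_tendsto_of_tendsto hlow hent (Filter.Eventually.of_forall fun j => ?_)
    have hnpos : (0 : ℝ) < n j := by exact_mod_cast Nat.pos_of_ne_zero (hn0 j)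
    have hm := misiurewicz hT hP (S j) q (n j) hq (Nat.pos_of_ne_zero (hn0 j)) (by
      intro x hx y hy hxy
      apply hsep j x hx y hy
      rw [nm_eq_iff] at hxy
      intro i hi
      exact hPd _ _ (hxy i hi))
    have hlog : s * n j ≤ Real.log (S j).card := by
      rw [Real.le_log_iff_exp_le]
      · exact hcard j
      · exact (Real.exp_pos _).trans_le (hcard j)
    have h3 : (q : ℝ) * (s * n j) ≤ q * Real.log (S j).card := by gcongr
    change (q : ℝ) * s - 2 * q * (k : ℝ) ^ q / n j ≤ partEntropy (ν j : Measure X) (nm T P q)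
    rw [hν j, sub_le_iff_le_add, ← sub_le_iff_le_add', le_div_iff₀ hnpos]
    nlinarith
  unfold hKS
  refine le_iSup_of_le k (le_iSup_of_le P (le_iSup_of_le hP ?_))
  apply ENNReal.ofReal_le_ofReal
  refine le_ciInf fun m => ?_
  rw [le_div_iff₀ (by positivity)]
  have := key (m + 1) (by omega)
  push_cast at this
  rw [mul_comm]
  exact this

theorem growth (q : ℕ) (c b : ℝ) (hc : 0 < c) (hb : 0 < b) :
    ∀ᶠ n : ℕ in atTop, ((n : ℝ) + 1) ^ q ≤ c * Real.exp (b * n) := by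
  have h := isLittleO_pow_exp_pos_mul_atTop q hb
  have h1 := h.def (show 0 < c * Real.exp (-b) by positivity)
  have h2 : Tendsto (fun n : ℕ => (n : ℝ) + 1) atTop atTop :=
    tendsto_atTop_add_const_right _ _ tendsto_natCast_atTop_atTop
  filter_upwards [h2.eventually h1] with n hn
  rw [Real.norm_of_nonneg (by positivity), Real.norm_of_nonneg (by positivity)] at hn
  refine hn.trans (le_of_eq ?_)
  rw [mul_assoc, ← Real.exp_add]
  ring_nf

open Classical in
theorem upper_bound (T : X → X) (hT : Continuous T) (r : ℕ)
    (Φ : (Fin r → X) → ℝ) (hΦ : Continuous Φ) (α : ℝ) [Nonempty X] :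
    htop T (Eset T Φ α) ≤ ⨆ μ ∈ Mset T Φ α, hKS T μ := by
  refine ENNReal.le_of_forall_nnreal_lt ?_
  intro s hs
  unfold htop at hs
  simp only [lt_iSup_iff] at hs
  obtain ⟨ε, hε, hs⟩ := hs
  obtain ⟨s1, hss1, hs1⟩ := ENNReal.lt_iff_exists_nnreal_btwn.1 hs
  have hss1' : (s : ℝ) < s1 := by exact_mod_cast hss1
  have hH : bowenH T (Eset T Φ α) s1 ε ≠ 0 := by
    intro h0
    exact absurd hs1 (not_lt.2 (iInf_le_of_le s1 (iInf_le _ h0)))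
  have hs1pos : (0 : ℝ) < s1 := lt_of_le_of_lt s.2 hss1'
  have hstep : ∀ j : ℕ, ∃ (n : ℕ) (S : Finset X), j ≤ n ∧ n ≠ 0 ∧ S.Nonempty ∧
      (∀ x ∈ S, |Vstat T Φ n x - α| ≤ 1 / ((j : ℝ) + 1)) ∧
      (∃ (q : ℕ) (Q : X → Fin q), Measurable Q ∧
      (∀ x y, Q x = Q y → dist x y < 1 / ((j : ℝ) + 1)) ∧
      ∀ x ∈ S, ∀ y ∈ S, ∀ l, (Finset.univ.filter fun i : Fin n => Q (T^[(i : ℕ) + 1] x) = l).card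
      = (Finset.univ.filter fun i : Fin n => Q (T^[(i : ℕ) + 1] y) = l).card) ∧
      (∀ x ∈ S, ∀ y ∈ S, y ∈ bowenBall T n ε x → x = y) ∧
      Real.exp (s * n) ≤ S.card := by
    intro j
    let Z : ℕ → Set X := fun N => {x | ∀ n ≥ N, |Vstat T Φ n x - α| ≤ 1 / ((j : ℝ) + 1)}
    have hZ : Eset T Φ α ⊆ ⋃ N, Z N := by
      intro x hx
      obtain ⟨N, hN⟩ := Metric.tendsto_atTop.1 hx (1 / ((j : ℝ) + 1)) (by positivity)
      refine Set.mem_iUnion.2 ⟨N, fun n hn => ?_⟩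
      have := hN n hn
      rw [Real.dist_eq] at this
      exact this.le
    obtain ⟨N, n0, hNn⟩ : ∃ N n0, bowenHn T (Z N) s1 ε n0 ≠ 0 := by
      by_contra hno
      push Not at hno
      apply hH
      unfold bowenH
      rw [ENNReal.iSup_eq_zero]
      intro n
      have h1 := bowenHn_iUnion_zero T Z s1 ε n (fun N => hno N n)
      refine le_antisymm ?_ zero_le
      rw [← h1]
      unfold bowenHn
      refine le_iInf fun c => le_iInf fun h1 => le_iInf fun h2 => ?_
      exact iInf_le_of_le c (iInf_le_of_le (hZ.trans h1) (iInf_le _ h2))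
    obtain ⟨c, hc, hsep⟩ := exists_separated T (Z N) s1 ε hs1pos hε n0 hNn
    obtain ⟨q, Q, D, hQm, hQd, -⟩ := exists_small_partition (0 : Measure X) (1 / ((j : ℝ) + 1))
      (by positivity)
    obtain ⟨n, hgr, hn1⟩ := ((growth q c (s1 - s) hc (sub_pos.2 hss1')).and
      (eventually_ge_atTop (n0 + N + j + 1))).exists
    obtain ⟨S, hSZ, hSs, hSc⟩ := hsep n (by omega)
    let f : X → (Fin q → Fin (n + 1)) := fun x l =>
      ⟨(Finset.univ.filter fun i : Fin n => Q (T^[(i : ℕ) + 1] x) = l).card, by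
        have := Finset.card_filter_le (Finset.univ : Finset (Fin n))
          (fun i : Fin n => Q (T^[(i : ℕ) + 1] x) = l)
        simp at this ⊢
        omega⟩
    obtain ⟨y, -, hy⟩ := Finset.exists_le_card_fiber_of_nsmul_le_card_of_maps_to
      (s := S) (t := Finset.univ) (f := f) (b := Real.exp (s * n)) (by simp) Finset.univ_nonempty (by
        rw [nsmul_eq_mul]
        simp only [Finset.card_univ, Fintype.card_fun, Fintype.card_fin]
        push_cast
        calc ((n : ℝ) + 1) ^ q * Real.exp (s * n) ≤ c * Real.exp ((s1 - s) * n) * Real.exp (s * n) := by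
              gcongr
          _ = c * Real.exp (s1 * n) := by rw [mul_assoc, ← Real.exp_add]; ring_nf
          _ ≤ _ := hSc)
    refine ⟨n, S.filter fun x => f x = y, by omega, by omega, ?_, ?_, ⟨q, Q, hQm, hQd, ?_⟩, ?_, hy⟩
    · rw [← Finset.card_pos]
      have := (Real.exp_pos _).trans_le hy
      exact_mod_cast this
    · intro x hx
      exact hSZ x (Finset.mem_filter.1 hx).1 n (by omega)
    · intro x hx x' hx' l
      have h1 := (Finset.mem_filter.1 hx).2
      have h2 := (Finset.mem_filter.1 hx').2
      have h3 := congrArg Fin.val (congrFun (h1.trans h2.symm) l)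
      simpa [f] using h3
    · intro x hx x' hx'
      exact hSs x (Finset.mem_filter.1 hx).1 x' (Finset.mem_filter.1 hx').1
  choose n S hnj hn0 hne hV hty hsep hcard using hstep
  have hn : Tendsto n atTop atTop := tendsto_atTop_mono hnj tendsto_id
  obtain ⟨U, μ, ν, hU, hμ, hν, hlim⟩ := exists_limit T hT Φ hΦ α n hn0 hn S hne hV
    (by intro j; convert hty j)
  have := limit_entropy hT ε s hε U hU μ hμ.2.1 ν hlim S n hn0 hn hν hsep hcard
  rw [ENNReal.ofReal_coe_nnreal] at this
  exact this.trans (le_iSup₂_of_le (μ : Measure X) hμ le_rfl)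

open Classical in
theorem empty_case (T : X → X) (hT : Continuous T) (r : ℕ)
    (Φ : (Fin r → X) → ℝ) (hΦ : Continuous Φ) (α : ℝ) (x : X) (hx : x ∈ Eset T Φ α) :
    (Mset T Φ α).Nonempty := by
  have hstep : ∀ j : ℕ, ∃ n : ℕ, j ≤ n ∧ n ≠ 0 ∧ |Vstat T Φ n x - α| ≤ 1 / ((j : ℝ) + 1) := by
    intro j
    obtain ⟨N, hN⟩ := Metric.tendsto_atTop.1 hx (1 / ((j : ℝ) + 1)) (by positivity)
    refine ⟨N + j + 1, by omega, by omega, ?_⟩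
    have := hN (N + j + 1) (by omega)
    rw [Real.dist_eq] at this
    exact this.le
  choose n hnj hn0 hV using hstep
  have hn : Tendsto n atTop atTop := tendsto_atTop_mono hnj tendsto_id
  obtain ⟨U, μ, ν, hU, hμ, -⟩ := exists_limit T hT Φ hΦ α n hn0 hn (fun _ => {x})
    (by simp) (by simpa using hV) (by
      intro j
      obtain ⟨q, Q, D, hQm, hQd, -⟩ := exists_small_partition (0 : Measure X) (1 / ((j : ℝ) + 1))
        (by positivity)
      refine ⟨q, Q, hQm, hQd, ?_⟩
      simp)
  exact ⟨μ, hμ⟩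

end Upper


section LLN
variable {X : Type*} [MeasurableSpace X]

theorem lln_ae (μ : Measure X) [IsProbabilityMeasure μ] (g : X → ℝ) (hg : Measurable g)
    (C : ℝ) (hC : ∀ x, |g x| ≤ C) :
    ∀ᵐ ω ∂(Measure.infinitePi (fun _ : ℕ => μ)),
      Tendsto (fun M : ℕ => (∑ i ∈ Finset.range M, g (ω i)) / M) atTop (𝓝 (∫ x, g x ∂μ)) := by
  have hmp : ∀ i : ℕ, MeasurePreserving (fun ω : ℕ → X => ω i)
      (Measure.infinitePi (fun _ : ℕ => μ)) μ := fun i =>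
    measurePreserving_eval_infinitePi (fun _ : ℕ => μ) i
  have hInteg : Integrable (fun ω : ℕ → X => g (ω 0)) (Measure.infinitePi (fun _ : ℕ => μ)) := by
    refine Integrable.of_bound (C := C) ?_ ?_
    · exact (hg.comp (measurable_pi_apply 0)).aestronglyMeasurable
    · exact Filter.Eventually.of_forall fun ω => by simpa using hC _
  have hind := ProbabilityTheory.iIndepFun_infinitePi (P := fun _ : ℕ => μ)
    (X := fun (_ : ℕ) (x : X) => g x) (fun _ => hg)
  have h := ProbabilityTheory.strong_law_ae_real (fun (i : ℕ) (ω : ℕ → X) => g (ω i)) hInteg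
    (fun i j hij => hind.indepFun hij) (fun i => by
      refine ⟨(hg.comp (measurable_pi_apply i)).aemeasurable,
        (hg.comp (measurable_pi_apply 0)).aemeasurable, ?_⟩
      have e : ∀ i : ℕ, Measure.map (fun ω : ℕ → X => g (ω i)) (Measure.infinitePi (fun _ : ℕ => μ))
        = μ.map g := by
        intro i
        have : (fun ω : ℕ → X => g (ω i)) = g ∘ (fun ω : ℕ → X => ω i) := rfl
        rw [this, ← Measure.map_map hg (measurable_pi_apply i), (hmp i).map_eq]
      rw [e, e])
  have e0 : ∫ ω : ℕ → X, g (ω 0) ∂(Measure.infinitePi (fun _ : ℕ => μ)) = ∫ x, g x ∂μ := by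
    rw [← (hmp 0).map_eq, integral_map (hmp 0).aemeasurable hg.aestronglyMeasurable, (hmp 0).map_eq]
  rw [e0] at h
  exact h

theorem lln (μ : Measure X) [IsProbabilityMeasure μ] (G : Set (X → ℝ)) (hG : G.Finite)
    (hm : ∀ g ∈ G, Measurable g) (hb : ∀ g ∈ G, ∃ C, ∀ x, |g x| ≤ C) (η : ℝ) (hη : 0 < η) :
    ∀ᶠ M : ℕ in atTop, (1 / 2 : ℝ≥0∞) ≤ Measure.infinitePi (fun _ : ℕ => μ)
      {ω | ∀ g ∈ G, |(∑ i ∈ Finset.range M, g (ω i)) - M * ∫ x, g x ∂μ| ≤ η * M} := by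
  set ℙ := Measure.infinitePi (fun _ : ℕ => μ)
  let A : ℕ → Set (ℕ → X) := fun M => {ω | ∀ M' ≥ M, ∀ g ∈ G,
    |(∑ i ∈ Finset.range M', g (ω i)) - M' * ∫ x, g x ∂μ| ≤ η * M'}
  have hmono : Monotone A := fun M1 M2 h ω hω M' hM' => hω M' (h.trans hM')
  have hfull : ℙ (⋃ M, A M) = 1 := by
    have hae : ∀ᵐ ω ∂ℙ, ω ∈ ⋃ M, A M := by
      have h1 : ∀ᵐ ω ∂ℙ, ∀ g ∈ G,
          Tendsto (fun M : ℕ => (∑ i ∈ Finset.range M, g (ω i)) / M) atTop (𝓝 (∫ x, g x ∂μ)) := by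
        rw [ae_ball_iff hG.countable]
        intro g hg
        obtain ⟨C, hC⟩ := hb g hg
        exact lln_ae μ g (hm g hg) C hC
      filter_upwards [h1] with ω hω
      have h2 : ∀ᶠ M : ℕ in atTop, ∀ g ∈ G,
          |(∑ i ∈ Finset.range M, g (ω i)) - M * ∫ x, g x ∂μ| ≤ η * M := by
        rw [Filter.eventually_all_finite hG]
        intro g hg
        have h3 := (Metric.tendsto_nhds.1 (hω g hg) η hη)
        filter_upwards [h3, eventually_gt_atTop 0] with M hM hM0
        have hM0' : (0 : ℝ) < M := by exact_mod_cast hM0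
        rw [Real.dist_eq] at hM
        have e : (∑ i ∈ Finset.range M, g (ω i)) - M * ∫ x, g x ∂μ =
          ((∑ i ∈ Finset.range M, g (ω i)) / M - ∫ x, g x ∂μ) * M := by field_simp
        rw [e, abs_mul, abs_of_pos hM0']
        gcongr
      obtain ⟨M, hM⟩ := eventually_atTop.1 h2
      exact Set.mem_iUnion.2 ⟨M, hM⟩
    rw [measure_eq_measure_of_null_sdiff (Set.subset_univ _) ?_, measure_univ]
    rw [← Set.compl_eq_univ_sdiff]
    exact hae
  have ht := tendsto_measure_iUnion_atTop (μ := ℙ) hmono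
  rw [hfull] at ht
  have hlt : (1 / 2 : ℝ≥0∞) < 1 := by
    rw [one_div]; exact ENNReal.inv_lt_one.2 (by norm_num)
  filter_upwards [ht.eventually (lt_mem_nhds hlt)] with M hM
  refine hM.le.trans (measure_mono ?_)
  intro ω hω
  exact hω M le_rfl

end LLN

section Code

open Classical in
theorem code {I : Type*} [Fintype I] {k : ℕ} (W : Finset (I → Fin k)) (D β : ℝ) (hβ : 0 ≤ β)
    (hD : 0 ≤ D) :
    ∃ C ⊆ W, (∀ w ∈ C, ∀ w' ∈ C, (hammingDist w w' : ℝ) ≤ D → w = w') ∧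
      (W.card : ℝ) ≤ C.card * Real.exp (β * D + k * Real.exp (-β) * Fintype.card I) := by
  have hex : ∃ C ∈ W.powerset.filter (fun C => ∀ w ∈ C, ∀ w' ∈ C, (hammingDist w w' : ℝ) ≤ D → w = w'),
      ∀ C' ∈ W.powerset.filter (fun C => ∀ w ∈ C, ∀ w' ∈ C, (hammingDist w w' : ℝ) ≤ D → w = w'),
      C'.card ≤ C.card := by
    apply Finset.exists_max_image
    exact ⟨∅, by simp⟩
  obtain ⟨C, hC, hmax⟩ := hex
  rw [Finset.mem_filter, Finset.mem_powerset] at hC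
  refine ⟨C, hC.1, hC.2, ?_⟩
  have hcov : ∀ w ∈ W, ∃ c ∈ C, (hammingDist c w : ℝ) ≤ D := by
    intro w hw
    by_contra hno
    push Not at hno
    have hwC : w ∉ C := by
      intro h
      have := hno w h
      rw [hammingDist_self] at this
      simp at this; linarith
    have := hmax (insert w C) (by
      rw [Finset.mem_filter, Finset.mem_powerset]
      refine ⟨Finset.insert_subset hw hC.1, ?_⟩
      intro a ha b hb hab
      rcases Finset.mem_insert.1 ha with h | ha <;> rcases Finset.mem_insert.1 hb with h' | hb
      · rw [h, h']
      · rw [h, hammingDist_comm] at hab; exact absurd hab (not_le.2 (hno b hb))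
      · rw [h'] at hab; exact absurd hab (not_le.2 (hno a ha))
      · exact hC.2 a ha b hb hab)
    rw [Finset.card_insert_of_notMem hwC] at this; omega
  have hball : ∀ c : I → Fin k, ((Finset.univ.filter fun w => (hammingDist c w : ℝ) ≤ D).card : ℝ) ≤
      Real.exp (β * D + k * Real.exp (-β) * Fintype.card I) := by
    intro c
    have h1 : ∑ w : I → Fin k, Real.exp (-β * hammingDist c w) ≤
        Real.exp (k * Real.exp (-β) * Fintype.card I) := by
      have e1 : ∀ w : I → Fin k, Real.exp (-β * hammingDist c w) =
          ∏ i, (if c i ≠ w i then Real.exp (-β) else 1) := by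
        intro w
        rw [Finset.prod_ite, Finset.prod_const, Finset.prod_const_one, mul_one, ← Real.exp_nat_mul,
          mul_comm, hammingDist]
      simp_rw [e1]
      have e2 := Finset.prod_univ_sum (fun _ : I => (Finset.univ : Finset (Fin k)))
        (fun i a => if c i ≠ a then Real.exp (-β) else 1)
      rw [Fintype.piFinset_univ] at e2
      rw [← e2]
      have e3 : ∀ i, ∑ a : Fin k, (if c i ≠ a then Real.exp (-β) else 1) ≤
          Real.exp (k * Real.exp (-β)) := by
        intro i
        calc _ ≤ ∑ a : Fin k, ((if c i = a then 1 else 0) + Real.exp (-β)) := by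
              refine Finset.sum_le_sum fun a _ => ?_
              by_cases h : c i = a
              · simp [h, (Real.exp_pos _).le]
              · simp [h]
          _ = k * Real.exp (-β) + 1 := by
              rw [Finset.sum_add_distrib]; simp; ring
          _ ≤ _ := Real.add_one_le_exp _
      calc _ ≤ ∏ i : I, Real.exp (k * Real.exp (-β)) := by
            refine Finset.prod_le_prod (fun i _ => ?_) (fun i _ => e3 i)
            refine Finset.sum_nonneg fun a _ => ?_
            split_ifs
            · exact (Real.exp_pos _).le
            · norm_num
        _ = _ := by
          rw [Finset.prod_const, ← Real.exp_nat_mul, Finset.card_univ]; ring_nf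
    have h2 : ((Finset.univ.filter fun w => (hammingDist c w : ℝ) ≤ D).card : ℝ) * Real.exp (-β * D) ≤
        ∑ w : I → Fin k, Real.exp (-β * hammingDist c w) := by
      rw [← nsmul_eq_mul, ← Finset.sum_const]
      refine (Finset.sum_le_sum ?_).trans (Finset.sum_le_sum_of_subset_of_nonneg
        (Finset.filter_subset _ _) (fun _ _ _ => (Real.exp_pos _).le))
      intro w hw
      rw [Finset.mem_filter] at hw
      apply Real.exp_le_exp.2
      nlinarith [hw.2]
    rw [Real.exp_add]
    have h3 := h2.trans h1
    rw [neg_mul, Real.exp_neg, ← div_eq_mul_inv, div_le_iff₀ (Real.exp_pos _)] at h3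
    linarith
  have h1 : W ⊆ C.biUnion (fun c => Finset.univ.filter fun w => (hammingDist c w : ℝ) ≤ D) := by
    intro w hw
    obtain ⟨c, hc, hcw⟩ := hcov w hw
    rw [Finset.mem_biUnion]
    exact ⟨c, hc, by simpa using hcw⟩
  have h2 := (Finset.card_le_card h1).trans Finset.card_biUnion_le
  calc (W.card : ℝ) ≤ ∑ c ∈ C, ((Finset.univ.filter fun w => (hammingDist c w : ℝ) ≤ D).card : ℝ) := by
        exact_mod_cast h2
    _ ≤ ∑ c ∈ C, Real.exp (β * D + k * Real.exp (-β) * Fintype.card I) :=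
        Finset.sum_le_sum fun c _ => hball c
    _ = _ := by rw [Finset.sum_const, nsmul_eq_mul]

end Code


section Words
variable {X : Type*} [MetricSpace X] [CompactSpace X] [MeasurableSpace X] [BorelSpace X]

theorem bad_set (μ : Measure X) [IsProbabilityMeasure μ] {k : ℕ} (P : X → Fin k)
    (hP : Measurable P) (η : ℝ) (hη : 0 < η) :
    ∃ B : Set X, MeasurableSet B ∧ μ.real B ≤ η ∧ ∃ ε > 0, ∀ x y, x ∉ B → y ∉ B →
      dist x y < ε → P x = P y := by
  have hk : (0:ℝ) < k + 1 := by positivity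
  have h1 : ∀ l : Fin k, ∃ K : Set X, K ⊆ P ⁻¹' {l} ∧ IsClosed K ∧
      μ (P ⁻¹' {l} \ K) < ENNReal.ofReal (η / (k + 1)) := by
    intro l
    obtain ⟨K, hK1, hK2, hK3⟩ := (hP (measurableSet_singleton l)).exists_isClosed_sdiff_lt
      (μ := μ) (measure_ne_top _ _) (ε := ENNReal.ofReal (η / (k + 1))) (by
        simp; positivity)
    exact ⟨K, hK1, hK2, hK3⟩
  choose K hKs hKc hKm using h1
  refine ⟨⋃ l, (P ⁻¹' {l} \ K l), ?_, ?_, ?_⟩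
  · exact MeasurableSet.iUnion fun l => (hP (measurableSet_singleton l)).diff (hKc l).measurableSet
  · have : μ.real (⋃ l, (P ⁻¹' {l} \ K l)) ≤ ∑ l, μ.real (P ⁻¹' {l} \ K l) :=
      measureReal_iUnion_fintype_le _
    refine this.trans ?_
    calc ∑ l, μ.real (P ⁻¹' {l} \ K l) ≤ ∑ l : Fin k, η / (k + 1) := by
          refine Finset.sum_le_sum fun l _ => ?_
          rw [measureReal_def]
          exact ENNReal.toReal_le_of_le_ofReal (by positivity) (hKm l).le
      _ = k * (η / (k + 1)) := by simp
      _ ≤ η := by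
          rw [mul_div_assoc', div_le_iff₀ hk]; nlinarith
  · have h2 : ∀ p : Fin k × Fin k, ∃ e > 0, p.1 ≠ p.2 → ∀ x ∈ K p.1, ∀ y ∈ K p.2, e ≤ dist x y := by
      intro ⟨l, l'⟩
      by_cases h : l = l'
      · exact ⟨1, one_pos, fun h' => absurd h h'⟩
      have hd : Disjoint (K l) (K l') := by
        rw [Set.disjoint_left]
        intro x hx hx'
        exact h ((hKs _ hx : P x = l).symm.trans (hKs _ hx'))
      obtain ⟨e, he, hd'⟩ := hd.exists_thickenings (hKc l).isCompact (hKc l')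
      refine ⟨e, he, fun _ x hx y hy => ?_⟩
      by_contra hlt
      push Not at hlt
      rw [Set.disjoint_left] at hd'
      refine hd' (a := x) (Metric.self_subset_thickening he _ hx) ?_
      rw [Metric.mem_thickening_iff]
      exact ⟨y, hy, hlt⟩
    choose e he1 he2 using h2
    have h3 : ∃ ε > 0, ∀ p, ε ≤ e p := by
      by_cases hne : Nonempty (Fin k × Fin k)
      · obtain ⟨p0, -, hp⟩ := Finset.exists_min_image Finset.univ e Finset.univ_nonempty
        exact ⟨e p0, he1 p0, fun p => hp p (Finset.mem_univ _)⟩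
      · exact ⟨1, one_pos, fun p => absurd ⟨p⟩ hne⟩
    obtain ⟨ε, hε, hεe⟩ := h3
    refine ⟨ε, hε, fun x y hx hy hxy => ?_⟩
    by_contra hne
    have hx' : x ∈ K (P x) := by
      by_contra h; exact hx (Set.mem_iUnion.2 ⟨P x, rfl, h⟩)
    have hy' : y ∈ K (P y) := by
      by_contra h; exact hy (Set.mem_iUnion.2 ⟨P y, rfl, h⟩)
    have := he2 (P x, P y) hne x hx' y hy'
    linarith [hεe (P x, P y)]

open Classical in
theorem words (μ : Measure X) [IsProbabilityMeasure μ] {T : X → X} (hT : Continuous T)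
    (hμ : MeasurePreserving T μ μ) {k : ℕ} (P : X → Fin k) (hP : Measurable P) (n : ℕ)
    (F : Set (X → ℝ)) (hF : F.Finite) (hm : ∀ g ∈ F, Measurable g)
    (hb : ∀ g ∈ F, ∃ C, ∀ x, |g x| ≤ C) (η : ℝ) (hη : 0 < η) :
    ∀ᶠ M : ℕ in atTop, ∃ W : Finset (Fin M × Fin n → Fin k),
      1 / 2 * Real.exp (M * (partEntropy μ (nm T P n) - η)) ≤ W.card ∧
      ∀ w ∈ W, ∃ ω : ℕ → X, (∀ i j, w (i, j) = P (T^[(j:ℕ)] (ω i))) ∧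
        ∀ f ∈ F, |∑ i ∈ Finset.range M, ∑ j ∈ Finset.range n, f (T^[j] (ω i))
          - M * (n * ∫ x, f x ∂μ)| ≤ η * M := by
  let S : (X → ℝ) → X → ℝ := fun f x => ∑ j ∈ Finset.range n, f (T^[j] x)
  let φ : (Fin n → Fin k) → ℝ := fun v => - Real.log (μ.real (nm T P n ⁻¹' {v}))
  have hnm := nm_measurable hT hP n
  have hφm : Measurable (fun x => φ (nm T P n x)) := (measurable_of_finite φ).comp hnm
  have hφI : ∫ x, φ (nm T P n x) ∂μ = partEntropy μ (nm T P n) := by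
    rw [← integral_map (φ := nm T P n) hnm.aemeasurable (measurable_of_finite φ).aestronglyMeasurable]
    have := Measure.isProbabilityMeasure_map (μ := μ) hnm.aemeasurable
    rw [integral_fintype Integrable.of_finite]
    unfold partEntropy
    refine Finset.sum_congr rfl fun v _ => ?_
    rw [measureReal_def, Measure.map_apply hnm (measurableSet_singleton v)]
    simp [φ, Real.negMulLog, measureReal_def]
  have hSm : ∀ f ∈ F, Measurable (S f) := fun f hf =>
    Finset.measurable_fun_sum _ fun j _ => (hm f hf).comp (hT.iterate j).measurable
  have hSI : ∀ f ∈ F, ∫ x, S f x ∂μ = n * ∫ x, f x ∂μ := by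
    intro f hf
    obtain ⟨C, hC⟩ := hb f hf
    have hi : ∀ j, Integrable (fun x => f (T^[j] x)) μ := fun j =>
      Integrable.of_bound (C := C) ((hm f hf).comp (hT.iterate j).measurable).aestronglyMeasurable
        (Filter.Eventually.of_forall fun x => by simpa using hC _)
    simp only [S]
    rw [integral_finsetSum _ fun j _ => hi j]
    have : ∀ j, ∫ x, f (T^[j] x) ∂μ = ∫ x, f x ∂μ := by
      intro j
      have hj := hμ.iterate j
      rw [← integral_map (φ := T^[j]) hj.aemeasurable (hm f hf).aestronglyMeasurable, hj.map_eq]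
    simp [this]
  have hL := lln μ (insert (fun x => φ (nm T P n x)) (S '' F)) ((hF.image S).insert _) (by
    rintro g (rfl | ⟨f, hf, rfl⟩)
    · exact hφm
    · exact hSm f hf) (by
    rintro g (rfl | ⟨f, hf, rfl⟩)
    · refine ⟨∑ v, |φ v|, fun x => ?_⟩
      exact Finset.single_le_sum (f := fun v => |φ v|) (fun v _ => abs_nonneg _) (Finset.mem_univ _)
    · obtain ⟨C, hC⟩ := hb f hf
      refine ⟨n * C, fun x => (Finset.abs_sum_le_sum_abs _ _).trans ?_⟩
      calc _ ≤ ∑ j ∈ Finset.range n, C := Finset.sum_le_sum fun j _ => hC _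
        _ = n * C := by simp) η hη
  filter_upwards [hL] with M hM
  set H := partEntropy μ (nm T P n)
  set G := {ω : ℕ → X | ∀ g ∈ insert (fun x => φ (nm T P n x)) (S '' F),
    |(∑ i ∈ Finset.range M, g (ω i)) - M * ∫ x, g x ∂μ| ≤ η * M} with hGdef
  let wd : (ℕ → X) → (Fin M × Fin n → Fin k) := fun ω p => P (T^[(p.2:ℕ)] (ω p.1))
  let W : Finset (Fin M × Fin n → Fin k) := Finset.univ.filter fun w => ∃ ω ∈ G, wd ω = w
  refine ⟨W, ?_, ?_⟩
  swap
  · intro w hw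
    obtain ⟨ω, hω, rfl⟩ := (Finset.mem_filter.1 hw).2
    refine ⟨ω, fun i j => rfl, fun f hf => ?_⟩
    have := hω (S f) (Set.mem_insert_of_mem _ ⟨f, hf, rfl⟩)
    rwa [hSI f hf] at this
  set ℙ := Measure.infinitePi (fun _ : ℕ => μ)
  let cyl : (Fin M × Fin n → Fin k) → Set (ℕ → X) := fun w => wd ⁻¹' {w}
  have hcyl : ∀ w ∈ W, ℙ (cyl w) ≤ ENNReal.ofReal (Real.exp (-(M * (H - η)))) := by
    intro w hw
    obtain ⟨ω, hω, rfl⟩ := (Finset.mem_filter.1 hw).2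
    have e1 : cyl (wd ω) ⊆ Set.pi (Finset.range M : Set ℕ)
        (fun i => nm T P n ⁻¹' {nm T P n (ω i)}) := by
      intro ω' hω' i hi
      have hi' : i < M := by simpa using hi
      change nm T P n (ω' i) = nm T P n (ω i)
      funext j
      exact congrFun (hω' : wd ω' = wd ω) (⟨i, hi'⟩, j)
    refine (measure_mono e1).trans ?_
    rw [Measure.infinitePi_pi _ (fun i _ => hnm (measurableSet_singleton _))]
    by_cases h0 : ∃ i ∈ Finset.range M, μ (nm T P n ⁻¹' {nm T P n (ω i)}) = 0
    · obtain ⟨i, hi, h0⟩ := h0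
      rw [Finset.prod_eq_zero hi h0]; exact zero_le
    push Not at h0
    have e2 : ∀ i ∈ Finset.range M, μ (nm T P n ⁻¹' {nm T P n (ω i)}) =
        ENNReal.ofReal (Real.exp (-φ (nm T P n (ω i)))) := by
      intro i hi
      have hp : 0 < μ.real (nm T P n ⁻¹' {nm T P n (ω i)}) :=
        ENNReal.toReal_pos (h0 i hi) (measure_ne_top _ _)
      simp only [φ, neg_neg]
      rw [Real.exp_log hp, ofReal_measureReal]
    rw [Finset.prod_congr rfl e2, ← ENNReal.ofReal_prod_of_nonneg (fun _ _ => (Real.exp_pos _).le),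
      ← Real.exp_sum]
    refine ENNReal.ofReal_le_ofReal (Real.exp_le_exp.2 ?_)
    have := hω _ (Set.mem_insert _ _)
    rw [hφI] at this
    have h3 := (abs_le.1 this).1
    rw [Finset.sum_neg_distrib]
    linarith
  have hsub : G ⊆ ⋃ w ∈ W, cyl w := by
    intro ω hω
    exact Set.mem_biUnion (x := wd ω) (by
      change wd ω ∈ W
      exact Finset.mem_filter.2 ⟨Finset.mem_univ _, ω, hω, rfl⟩) rfl
  have h4 : (1/2 : ℝ≥0∞) ≤ W.card * ENNReal.ofReal (Real.exp (-(M * (H - η)))) := by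
    calc (1/2 : ℝ≥0∞) ≤ ℙ G := hM
      _ ≤ ℙ (⋃ w ∈ W, cyl w) := measure_mono hsub
      _ ≤ ∑ w ∈ W, ℙ (cyl w) := measure_biUnion_finset_le _ _
      _ ≤ ∑ w ∈ W, ENNReal.ofReal (Real.exp (-(M * (H - η)))) := Finset.sum_le_sum hcyl
      _ = _ := by simp
  have h5 : (1/2 : ℝ) ≤ W.card * Real.exp (-(M * (H - η))) := by
    have := ENNReal.toReal_mono (by finiteness) h4
    rw [ENNReal.toReal_mul, ENNReal.toReal_ofReal (Real.exp_pos _).le] at this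
    simpa using this
  calc 1/2 * Real.exp (M * (H - η)) ≤ W.card * Real.exp (-(M * (H - η))) * Real.exp (M * (H - η)) := by
        gcongr
    _ = W.card := by rw [mul_assoc, ← Real.exp_add]; simp
end Words


section Segments
variable {X : Type*} [MetricSpace X]

/-- `m` is a specification gap for precision `ε`. -/
def IsGap (T : X → X) (ε : ℝ) (m : ℕ) : Prop :=
  ∀ k : ℕ, 2 ≤ k → ∀ (x : Fin k → X) (a b : Fin k → ℕ),
      (∀ i, a i ≤ b i) →
      (∀ i : Fin k, ∀ h : (i : ℕ) + 1 < k, b i + m ≤ a ⟨(i : ℕ) + 1, h⟩) →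
      ∃ y : X, ∀ i : Fin k, ∀ n : ℕ, a i + n ≤ b i →
        dist (T^[a i + n] y) (T^[n] (x i)) < ε

theorem glue {T : X → X} {ε : ℝ} {m : ℕ} (hg : IsGap T ε m) (M n : ℕ) (hM : 2 ≤ M) (hn : 1 ≤ n)
    (ω : ℕ → X) : ∃ y, ∀ i < M, ∀ j < n, dist (T^[i * (n + m) + j] y) (T^[j] (ω i)) < ε := by
  obtain ⟨y, hy⟩ := hg M hM (fun i => ω i) (fun i => i * (n + m)) (fun i => i * (n + m) + (n - 1))
    (fun i => by omega) (fun i h => by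
      simp only
      rw [add_mul, one_mul]
      omega)
  exact ⟨y, fun i hi j hj => hy ⟨i, hi⟩ j (by simp only; omega)⟩

theorem sum_range_mul_eq (g : ℕ → ℝ) (M q : ℕ) :
    ∑ t ∈ Finset.range (M * q), g t = ∑ i ∈ Finset.range M, ∑ j ∈ Finset.range q, g (i * q + j) := by
  induction M with
  | zero => simp
  | succ M ih => rw [add_mul, one_mul, Finset.sum_range_add, ih, Finset.sum_range_succ]

/-- Sum along a piece shadowing an orbit segment after (or before) a gap. -/
theorem seg_est {g v : ℕ → ℝ} {n m : ℕ} {C δ I : ℝ} (hC : ∀ t, |g t| ≤ C) (hI : |I| ≤ C)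
    (h : ∀ j < n, |g j - v j| ≤ δ) :
    |∑ j ∈ Finset.range (n + m), g j - (∑ j ∈ Finset.range n, v j + m * I)| ≤ n * δ + 2 * m * C := by
  rw [Finset.sum_range_add]
  have h1 : |∑ j ∈ Finset.range n, g j - ∑ j ∈ Finset.range n, v j| ≤ n * δ := by
    rw [← Finset.sum_sub_distrib]
    refine (Finset.abs_sum_le_sum_abs _ _).trans ?_
    refine (Finset.sum_le_sum fun j hj => h j (Finset.mem_range.1 hj)).trans ?_
    simp
  have h2 : |∑ j ∈ Finset.range m, g (n + j)| ≤ m * C := by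
    refine (Finset.abs_sum_le_sum_abs _ _).trans ?_
    refine (Finset.sum_le_sum fun j hj => hC _).trans ?_
    simp
  have h3 : |(m:ℝ) * I| ≤ m * C := by
    rw [abs_mul, Nat.abs_cast]; gcongr
  rw [abs_le] at *
  constructor <;> linarith

theorem block_est {g : ℕ → ℝ} {v : ℕ → ℕ → ℝ} {M n m : ℕ} {C δ η I : ℝ} (hC : ∀ t, |g t| ≤ C)
    (hI : |I| ≤ C) (h : ∀ i < M, ∀ j < n, |g (i * (n + m) + j) - v i j| ≤ δ)
    (hv : |∑ i ∈ Finset.range M, ∑ j ∈ Finset.range n, v i j - M * (n * I)| ≤ η * M) :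
    |∑ t ∈ Finset.range (M * (n + m)), g t - (M * (n + m) : ℝ) * I| ≤
      M * (n * δ + 2 * m * C) + η * M := by
  rw [sum_range_mul_eq]
  have h1 : |∑ i ∈ Finset.range M, ∑ j ∈ Finset.range (n + m), g (i * (n + m) + j)
      - ∑ i ∈ Finset.range M, (∑ j ∈ Finset.range n, v i j + m * I)| ≤ M * (n * δ + 2 * m * C) := by
    rw [← Finset.sum_sub_distrib]
    refine (Finset.abs_sum_le_sum_abs _ _).trans ?_
    refine (Finset.sum_le_sum fun i hi => seg_est (fun t => hC _) hI
      (h i (Finset.mem_range.1 hi))).trans ?_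
    simp [mul_add]
  rw [Finset.sum_add_distrib, Finset.sum_const, Finset.card_range, nsmul_eq_mul] at h1
  rw [abs_le] at *
  constructor <;> linarith

variable [CompactSpace X] [MeasurableSpace X] [BorelSpace X]

set_option maxHeartbeats 1600000 in
open Classical in
theorem good_segments (μ : Measure X) [IsProbabilityMeasure μ] {T : X → X} (hT : Continuous T)
    (hspec : Specification T)
    (hμ : MeasurePreserving T μ μ) {k : ℕ} (P : X → Fin k) (hP : Measurable P) (h s : ℝ)
    (hh : ∀ n : ℕ, (n + 1) * h ≤ partEntropy μ (nm T P (n + 1))) (hs : 0 ≤ s) (hsh : s < h) :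
    ∃ ε0 > 0, ∀ (F : Finset C(X, ℝ)) (δ : ℝ), 0 < δ → ∀ N0 : ℕ, ∃ L ≥ N0, 1 ≤ L ∧
      ∃ S : Finset X, Real.exp (s * L) ≤ S.card ∧
        (∀ x ∈ S, ∀ y ∈ S, y ∈ bowenBall T L ε0 x → x = y) ∧
        ∀ x ∈ S, ∀ f ∈ F, |∑ j ∈ Finset.range L, f (T^[j] x) - L * ∫ x, f x ∂μ| ≤ δ * L := by
  obtain ⟨γ, hγ, hγ5⟩ : ∃ γ > 0, 5 * γ = h - s := ⟨(h - s) / 5, by linarith, by ring⟩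
  obtain ⟨β, hβ0, hβ⟩ : ∃ β ≥ 0, (k:ℝ) * Real.exp (-β) ≤ γ := by
    have h1 : Tendsto (fun β : ℝ => (k:ℝ) * Real.exp (-β)) atTop (𝓝 0) := by
      simpa using (Real.tendsto_exp_neg_atTop_nhds_zero.const_mul (k:ℝ))
    obtain ⟨β, h2, h3⟩ := ((h1.eventually (gt_mem_nhds hγ)).and (eventually_ge_atTop 0)).exists
    exact ⟨β, h3, h2.le⟩
  obtain ⟨η', hη', hη'β⟩ : ∃ η' > 0, β * (4 * η') ≤ γ := by
    refine ⟨γ / (4 * (β + 1)), by positivity, ?_⟩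
    have : β * (4 * (γ / (4 * (β + 1)))) = γ * (β / (β + 1)) := by field_simp
    rw [this]
    have : β / (β + 1) ≤ 1 := by rw [div_le_one (by positivity)]; linarith
    nlinarith
  obtain ⟨B, hBm, hBμ, ε1, hε1, hB⟩ := bad_set μ P hP η' hη'
  refine ⟨ε1 / 2, by positivity, fun F δ hδ N0 => ?_⟩
  -- modulus of continuity
  obtain ⟨ε', hε', hε'1, huc⟩ : ∃ ε' > 0, ε' ≤ ε1 / 4 ∧ ∀ f ∈ F, ∀ x y : X, dist x y < ε' →
      |f x - f y| ≤ δ / 3 := by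
    have h1 : ∀ f : C(X, ℝ), ∃ e > 0, ∀ x y : X, dist x y < e → |f x - f y| ≤ δ / 3 := by
      intro f
      obtain ⟨e, he, h⟩ := Metric.uniformContinuous_iff.1
        (CompactSpace.uniformContinuous_of_continuous f.continuous) (δ / 3) (by positivity)
      exact ⟨e, he, fun x y hxy => by have := h hxy; rw [Real.dist_eq] at this; exact this.le⟩
    choose e he1 he2 using h1
    have h2 : ∃ e0 > 0, ∀ f ∈ F, e0 ≤ e f := by
      by_cases hne : F.Nonempty
      · obtain ⟨p0, -, hp⟩ := Finset.exists_min_image F e hne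
        exact ⟨e p0, he1 p0, fun p => hp p⟩
      · exact ⟨1, one_pos, fun f hf => absurd ⟨f, hf⟩ hne⟩
    obtain ⟨e0, he0, he0'⟩ := h2
    refine ⟨min (ε1 / 4) e0, by positivity, min_le_left _ _, fun f hf x y hxy =>
      he2 f x y (hxy.trans_le ((min_le_right _ _).trans (he0' f hf)))⟩
  obtain ⟨m, hm1, hgap⟩ := hspec ε' hε'
  obtain ⟨C, hC0, hC⟩ : ∃ C ≥ 0, ∀ f ∈ F, ∀ x : X, |f x| ≤ C := by
    refine ⟨∑ f ∈ F, ‖f‖, Finset.sum_nonneg fun _ _ => norm_nonneg _, fun f hf x => ?_⟩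
    exact (f.norm_coe_le_norm x).trans
      (Finset.single_le_sum (f := fun f : C(X, ℝ) => ‖f‖) (fun _ _ => norm_nonneg _) hf)
  have hCI : ∀ f ∈ F, |∫ x, f x ∂μ| ≤ C := by
    intro f hf
    have := norm_integral_le_of_norm_le_const (μ := μ) (f := f) (C := C)
      (Filter.Eventually.of_forall fun x => hC f hf x)
    simpa using this
  obtain ⟨n', hn1, hn2⟩ : ∃ n' : ℕ, 2 * m * C ≤ (n' + 1 : ℕ) * (δ / 3) ∧ s * m ≤ γ * (n' + 1 : ℕ) := by
    obtain ⟨a, ha⟩ := exists_nat_ge (2 * m * C / (δ / 3))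
    obtain ⟨b, hb⟩ := exists_nat_ge (s * m / γ)
    refine ⟨max a b, ?_, ?_⟩
    · rw [div_le_iff₀ (by positivity)] at ha
      refine ha.trans ?_
      gcongr
      exact_mod_cast (le_max_left a b).trans (Nat.le_succ _)
    · rw [div_le_iff₀ (by positivity)] at hb
      rw [mul_comm γ]
      refine hb.trans ?_
      gcongr
      exact_mod_cast (le_max_right a b).trans (Nat.le_succ _)
  have hhn := hh n'
  set n := n' + 1 with hn
  have hnpos : 1 ≤ n := by omega
  have hnR : (1:ℝ) ≤ n := by exact_mod_cast hnpos
  have hhn' : n * h ≤ partEntropy μ (nm T P n) := by rw [hn]; push_cast; exact hhn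
  set η := min γ (min (δ / 3) η') with hηdef
  have hη : 0 < η := by positivity
  have hη1 : η ≤ γ := min_le_left _ _
  have hη2 : η ≤ δ / 3 := (min_le_right _ _).trans (min_le_left _ _)
  have hη3 : η ≤ η' := (min_le_right _ _).trans (min_le_right _ _)
  let b : X → ℝ := B.indicator 1
  have hev := words μ hT hμ P hP n (insert b ((fun f : C(X, ℝ) => (f : X → ℝ)) '' F))
    ((F.finite_toSet.image _).insert _) (by
      rintro g (rfl | ⟨f, -, rfl⟩)
      · exact measurable_one.indicator hBm
      · exact f.continuous.measurable) (by
      rintro g (rfl | ⟨f, hf, rfl⟩)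
      · refine ⟨1, fun x => ?_⟩
        by_cases hx : x ∈ B <;> simp [b, hx]
      · exact ⟨C, hC f hf⟩) η hη
  obtain ⟨c, hc⟩ := exists_nat_ge (Real.log 2 / γ)
  obtain ⟨M, ⟨W, hWc, hW⟩, hM2, hMN, hMc⟩ := (hev.and ((eventually_ge_atTop 2).and
    ((eventually_ge_atTop N0).and (eventually_ge_atTop c)))).exists
  have hlog : Real.log 2 ≤ M * γ := by
    rw [div_le_iff₀ hγ] at hc
    refine hc.trans ?_
    gcongr
  have hMpos : (0:ℝ) < M := by exact_mod_cast (by omega : 0 < M)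
  set D : ℝ := 4 * η' * M * n with hD
  obtain ⟨K, hKW, hKsep, hKcard⟩ := code W D β hβ0 (by positivity)
  -- points
  have hy : ∀ w ∈ W, ∃ (ω : ℕ → X) (y : X), (∀ i j, w (i, j) = P (T^[(j:ℕ)] (ω i))) ∧
      (∀ f ∈ insert b ((fun f : C(X, ℝ) => (f : X → ℝ)) '' F),
        |∑ i ∈ Finset.range M, ∑ j ∈ Finset.range n, f (T^[j] (ω i))
          - M * (n * ∫ x, f x ∂μ)| ≤ η * M) ∧
      ∀ i < M, ∀ j < n, dist (T^[i * (n + m) + j] y) (T^[j] (ω i)) < ε' := by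
    intro w hw
    obtain ⟨ω, h1, h2⟩ := hW w hw
    obtain ⟨y, hy⟩ := glue hgap M n hM2 hnpos ω
    exact ⟨ω, y, h1, h2, hy⟩
  have hX : Nonempty X := nonempty_of_isProbabilityMeasure μ
  choose! om y ho1 ho2 ho3 using hy
  have hbsum : ∀ w ∈ W, ∑ i ∈ Finset.range M, ∑ j ∈ Finset.range n, b (T^[j] (om w i)) ≤ 2 * η' * M * n := by
    intro w hw
    have h1 := ho2 w hw b (Set.mem_insert _ _)
    have h2 : ∫ x, b x ∂μ = μ.real B := by simp [b, integral_indicator_one hBm]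
    rw [h2] at h1
    have h3 := (abs_le.1 h1).2
    have h4 : (M:ℝ) * (n * μ.real B) ≤ M * (n * η') := by gcongr
    have h5 : η * M ≤ η' * M * n := by
      have : η * M ≤ η' * M := by gcongr
      nlinarith [mul_pos hη' hMpos]
    nlinarith
  have hsep : ∀ w ∈ K, ∀ w' ∈ K, y w' ∈ bowenBall T (M * (n + m)) (ε1 / 2) (y w) → w = w' := by
    intro w hw w' hw' hball
    refine hKsep w hw w' hw' ?_
    have hwW := hKW hw
    have hwW' := hKW hw'
    have h1 : ∀ i : Fin M, ∀ j : Fin n, (if w (i, j) ≠ w' (i, j) then (1:ℝ) else 0) ≤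
        b (T^[(j:ℕ)] (om w i)) + b (T^[(j:ℕ)] (om w' i)) := by
      intro i j
      have hb0 : ∀ x, 0 ≤ b x := fun x => Set.indicator_nonneg (fun _ _ => zero_le_one) x
      split_ifs with hne
      · by_contra hlt
        push Not at hlt
        have hx : ∀ x, b x < 1 → x ∉ B := fun x h hx => by simp [b, hx] at h
        refine hne ?_
        rw [ho1 w hwW, ho1 w' hwW']
        refine hB _ _ (hx _ (by linarith [hb0 (T^[(j:ℕ)] (om w' i))]))
          (hx _ (by linarith [hb0 (T^[(j:ℕ)] (om w i))])) ?_
        have hlt' : (i:ℕ) * (n + m) + j < M * (n + m) := by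
          have : ((i:ℕ) + 1) * (n + m) ≤ M * (n + m) := Nat.mul_le_mul_right _ i.2
          have := j.2
          rw [add_mul, one_mul] at *
          omega
        have d1 := hball _ hlt'
        have d2 := ho3 w hwW i i.2 j j.2
        have d3 := ho3 w' hwW' i i.2 j j.2
        rw [dist_comm] at d2
        have := dist_triangle4 (T^[(j:ℕ)] (om w i)) (T^[(i:ℕ) * (n + m) + j] (y w))
          (T^[(i:ℕ) * (n + m) + j] (y w')) (T^[(j:ℕ)] (om w' i))
        linarith
      · exact add_nonneg (hb0 _) (hb0 _)
    have h2 : (hammingDist w w' : ℝ) = ∑ i : Fin M, ∑ j : Fin n, (if w (i, j) ≠ w' (i, j) then (1:ℝ) else 0) := by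
      rw [← Fintype.sum_prod_type' (f := fun i j => if w (i, j) ≠ w' (i, j) then (1:ℝ) else 0)]
      rw [Finset.sum_boole]
      unfold hammingDist
      congr
    rw [h2]
    refine (Finset.sum_le_sum fun i _ => Finset.sum_le_sum fun j _ => h1 i j).trans ?_
    have h3 := hbsum w hwW
    have h4 := hbsum w' hwW'
    simp only [Finset.sum_range] at h3 h4
    simp only [Finset.sum_add_distrib]
    rw [hD]
    linarith
  have hinj : Set.InjOn y K := by
    intro w hw w' hw' he
    refine hsep w hw w' hw' ?_
    rw [← he]
    intro j _
    simp; positivity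
  have hnm0 : 1 ≤ n + m := by omega
  refine ⟨M * (n + m), hMN.trans (Nat.le_mul_of_pos_right _ (by omega)), 
    Nat.mul_pos (by omega) (by omega), K.image y, ?_, ?_, ?_⟩
  · rw [Finset.card_image_of_injOn hinj]
    have e1 : 1 / 2 * Real.exp (M * (partEntropy μ (nm T P n) - η)) ≤
        K.card * Real.exp (β * D + k * Real.exp (-β) * (M * n)) := by
      refine hWc.trans (hKcard.trans ?_)
      simp
    have e2 : Real.exp (s * (M * (n + m) : ℕ)) * Real.exp (β * D + k * Real.exp (-β) * (M * n)) ≤ 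
        1 / 2 * Real.exp (M * (partEntropy μ (nm T P n) - η)) := by
      have : (1/2 : ℝ) = Real.exp (-Real.log 2) := by
        rw [Real.exp_neg, Real.exp_log two_pos]; norm_num
      rw [this, ← Real.exp_add, ← Real.exp_add, Real.exp_le_exp]
      have q1 : β * D ≤ γ * (M * n) := by
        rw [hD]
        calc β * (4 * η' * M * n) = (β * (4 * η')) * (M * n) := by ring
          _ ≤ γ * (M * n) := by gcongr
      have q2 : (k:ℝ) * Real.exp (-β) * (M * n) ≤ γ * (M * n) := by gcongr
      have q3 : (M:ℝ) * (n * h - γ) ≤ M * (partEntropy μ (nm T P n) - η) := by gcongr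
      have q4 : M * (s * m) ≤ M * (γ * n) := by gcongr
      have q5 : M * γ ≤ M * n * γ := by nlinarith [mul_pos hMpos hγ]
      have q6 : h = s + 5 * γ := by linarith
      push_cast
      rw [q6] at q3
      nlinarith
    exact le_of_mul_le_mul_right (e2.trans e1) (Real.exp_pos _)
  · intro x hx x' hx' hb
    obtain ⟨w, hw, rfl⟩ := Finset.mem_image.1 hx
    obtain ⟨w', hw', rfl⟩ := Finset.mem_image.1 hx'
    rw [hsep w hw w' hw' hb]
  · intro x hx f hf
    obtain ⟨w, hw, rfl⟩ := Finset.mem_image.1 hx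
    have hwW := hKW hw
    have := block_est (g := fun t => f (T^[t] (y w))) (v := fun i j => f (T^[j] (om w i)))
      (M := M) (n := n) (m := m) (C := C) (δ := δ / 3) (η := η) (I := ∫ x, f x ∂μ)
      (fun t => hC f hf _) (hCI f hf)
      (fun i hi j hj => huc f hf _ _ (ho3 w hwW i hi j hj))
      (ho2 w hwW f (Set.mem_insert_of_mem _ ⟨f, hf, rfl⟩))
    push_cast
    refine this.trans ?_
    have r1 : M * (2 * m * C) ≤ M * (n * (δ / 3)) := by gcongr
    have r2 : η * M ≤ δ / 3 * M * n := by
      have : η * M ≤ δ / 3 * M := by gcongr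
      nlinarith [mul_pos hδ hMpos]
    have r3 : 0 ≤ δ * (M * m) := by positivity
    nlinarith
end Segments


section Schedule

theorem exists_blocks (K : ℕ → ℕ) (hK : StrictMono K) (h0 : K 0 = 0) :
    ∃ p : ℕ → ℕ, ∀ k, K (p k) ≤ k ∧ k < K (p k + 1) := by
  refine ⟨fun k => Nat.findGreatest (fun q => K q ≤ k) k, fun k => ⟨?_, ?_⟩⟩
  · exact Nat.findGreatest_spec (P := fun q => K q ≤ k) (m := 0) (Nat.zero_le _) (by omega)
  · by_contra h
    push Not at h
    have h1 := hK.le_apply (x := Nat.findGreatest (fun q => K q ≤ k) k + 1)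
    have := Nat.le_findGreatest (P := fun q => K q ≤ k) (h1.trans h) h
    omega

theorem blocks_unique {K : ℕ → ℕ} (hK : StrictMono K) {k q q' : ℕ} (h1 : K q ≤ k)
    (h2 : k < K (q + 1)) (h3 : K q' ≤ k) (h4 : k < K (q' + 1)) : q = q' := by
  have a1 := hK.lt_iff_lt.1 (h1.trans_lt h4)
  have a2 := hK.lt_iff_lt.1 (h3.trans_lt h2)
  omega

/-- partial sums of the cell lengths -/
def csum (ℓ : ℕ → ℕ) (k : ℕ) : ℕ := ∑ i ∈ Finset.range k, ℓ i

theorem csum_succ (ℓ : ℕ → ℕ) (k : ℕ) : csum ℓ (k + 1) = csum ℓ k + ℓ k := Finset.sum_range_succ _ _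

theorem csum_strictMono (ℓ : ℕ → ℕ) (hℓ : ∀ k, 1 ≤ ℓ k) : StrictMono (csum ℓ) :=
  strictMono_nat_of_lt_succ fun k => by rw [csum_succ]; have := hℓ k; omega

theorem avg_tendsto (u : ℕ → ℝ) (C : ℝ) (hC : ∀ t, |u t| ≤ C) (ℓ : ℕ → ℕ) (hℓ : ∀ k, 1 ≤ ℓ k)
    (h1 : ∀ ε : ℝ, 0 < ε → ∀ᶠ k in atTop,
      |∑ t ∈ Finset.range (ℓ k), u (csum ℓ k + t)| ≤ ε * ℓ k)
    (h2 : ∀ ε : ℝ, 0 < ε → ∀ᶠ k in atTop, (ℓ k : ℝ) ≤ ε * csum ℓ k) :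
    Tendsto (fun n : ℕ => (∑ t ∈ Finset.range n, u t) / n) atTop (𝓝 0) := by
  have hsm := csum_strictMono ℓ hℓ
  have hC0 : 0 ≤ C := (abs_nonneg _).trans (hC 0)
  obtain ⟨p, hp⟩ := exists_blocks (csum ℓ) hsm (by simp [csum])
  rw [Metric.tendsto_atTop]
  intro ε hε
  obtain ⟨k0, hk0⟩ := eventually_atTop.1 ((h1 (ε / 4) (by positivity)).and
    (h2 (ε / (4 * (C + 1))) (by positivity)))
  set A := |∑ t ∈ Finset.range (csum ℓ k0), u t| with hA
  have hA0 : 0 ≤ A := abs_nonneg _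
  have hind : ∀ k ≥ k0, |∑ t ∈ Finset.range (csum ℓ k), u t| ≤ A + ε / 4 * csum ℓ k := by
    intro k hk
    induction k, hk using Nat.le_induction with
    | base => have : (0:ℝ) ≤ ε / 4 * csum ℓ k0 := by positivity
              linarith
    | succ k hk ih =>
      rw [csum_succ, Finset.sum_range_add]
      refine (abs_add_le _ _).trans ?_
      have := (hk0 k hk).1
      push_cast
      linarith
  obtain ⟨N, hN⟩ := exists_nat_ge (A / (ε / 4))
  refine ⟨max (csum ℓ k0) N + 1, fun n hn => ?_⟩
  have hn1 : csum ℓ k0 < n := lt_of_le_of_lt (le_max_left _ N) hn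
  have hn2 : N ≤ n := (le_max_right (csum ℓ k0) N).trans (by omega)
  have hnpos : (0:ℝ) < n := by exact_mod_cast (by omega : 0 < n)
  obtain ⟨hp1, hp2⟩ := hp n
  set k := p n
  have hk : k0 ≤ k := by
    have := hsm.lt_iff_lt.1 (hn1.trans hp2)
    omega
  rw [Real.dist_eq, sub_zero, abs_div, Nat.abs_cast, div_lt_iff₀ hnpos]
  obtain ⟨d, hd⟩ := Nat.exists_eq_add_of_le hp1
  have hdℓ : d ≤ ℓ k := by rw [csum_succ] at hp2; omega
  rw [show Finset.range n = Finset.range (csum ℓ k + d) by rw [hd], Finset.sum_range_add]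
  refine (abs_add_le _ _).trans_lt ?_
  have e1 := hind k hk
  have e2 : |∑ t ∈ Finset.range d, u (csum ℓ k + t)| ≤ d * C := by
    refine (Finset.abs_sum_le_sum_abs _ _).trans ?_
    refine (Finset.sum_le_sum fun j hj => hC _).trans ?_
    simp
  have e3 : (d:ℝ) * C ≤ ℓ k * C := by gcongr
  have e4 : (ℓ k : ℝ) * C ≤ ε / 4 * csum ℓ k := by
    have := (hk0 k hk).2
    calc (ℓ k : ℝ) * C ≤ (ε / (4 * (C + 1)) * csum ℓ k) * (C + 1) := by gcongr; linarith
      _ = ε / 4 * csum ℓ k := by field_simp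
  have e5 : ε / 4 * csum ℓ k ≤ ε / 4 * n := by gcongr
  have e6 : A ≤ ε / 4 * n := by
    rw [div_le_iff₀ (by positivity)] at hN
    rw [mul_comm]
    refine hN.trans ?_
    gcongr
  have : 0 < ε * n := by positivity
  linarith
end Schedule

section InfSpec
variable {X : Type*} [MetricSpace X]

theorem spec_step {T : X → X} {ε : ℝ} {m : ℕ} (hg : IsGap T ε m) (x : ℕ → X) (z : X) (c0 : ℕ)
    (a b : ℕ → ℕ) (N : ℕ) (hN : 1 ≤ N) (hab : ∀ i < N, a i ≤ b i) (h0 : c0 + m ≤ a 0)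
    (hba : ∀ i, i + 1 < N → b i + m ≤ a (i + 1)) :
    ∃ y, (∀ t < c0, dist (T^[t] y) (T^[t] z) < ε) ∧
      ∀ i < N, ∀ j, a i + j ≤ b i → dist (T^[a i + j] y) (T^[j] (x i)) < ε := by
  obtain ⟨y, hy⟩ := hg (N + 1) (by omega) (Fin.cons z (fun i => x i)) (Fin.cons 0 (fun i => a i))
    (Fin.cons (c0 - 1) (fun i => b i)) (by
      intro i
      refine Fin.cases ?_ (fun i => ?_) i
      · simp
      · simpa using hab i i.2) (by
      intro i
      refine Fin.cases ?_ (fun i => ?_) i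
      · intro h
        have : (⟨((0 : Fin (N + 1)) : ℕ) + 1, h⟩ : Fin (N + 1)) = Fin.succ ⟨0, hN⟩ := rfl
        rw [this, Fin.cons_succ, Fin.cons_zero]
        simp only
        omega
      · intro h
        have h' : (i : ℕ) + 1 < N := by simpa using h
        have : (⟨(Fin.succ i : ℕ) + 1, h⟩ : Fin (N + 1)) = Fin.succ ⟨(i:ℕ) + 1, h'⟩ := rfl
        rw [this, Fin.cons_succ, Fin.cons_succ]
        exact hba i h')
  refine ⟨y, fun t ht => ?_, fun i hi j hj => ?_⟩
  · have := hy 0 t (by simp only [Fin.cons_zero]; omega)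
    simpa using this
  · exact hy (Fin.succ ⟨i, hi⟩) j hj

variable [CompactSpace X]

theorem inf_spec {T : X → X} (hT : Continuous T) (e : ℕ → ℝ) (he : ∀ q, 2 * e (q + 1) ≤ e q)
    (m L : ℕ → ℕ) (hg : ∀ q, IsGap T (e q) (m q)) (hL : ∀ q, 1 ≤ L q)
    (K : ℕ → ℕ) (hK : StrictMono K) (hK0 : K 0 = 0) (p : ℕ → ℕ)
    (hp : ∀ k, K (p k) ≤ k ∧ k < K (p k + 1)) (x : ℕ → X) :
    ∃ z, ∀ k, ∀ j < L (p k),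
      dist (T^[csum (fun k => m (p k) + L (p k)) k + m (p k) + j] z) (T^[j] (x k)) ≤ 2 * e (p k) := by
  set c := csum (fun k => m (p k) + L (p k)) with hc
  have hpK : ∀ q i, i < K (q + 1) - K q → p (K q + i) = q := fun q i hi =>
    blocks_unique hK (hp _).1 (hp _).2 (by omega) (by omega)
  have hcs : ∀ k, c (k + 1) = c k + (m (p k) + L (p k)) := fun k => csum_succ _ k
  have hcm : StrictMono c := csum_strictMono _ fun k => by have := hL (p k); omega
  have hstep : ∀ q (z : X), ∃ y, (∀ t < c (K q), dist (T^[t] y) (T^[t] z) < e q) ∧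
      ∀ k, p k = q → ∀ j < L q, dist (T^[c k + m q + j] y) (T^[j] (x k)) < e q := by
    intro q z
    have hKq : K q < K (q + 1) := hK (Nat.lt_succ_self q)
    obtain ⟨y, hy1, hy2⟩ := spec_step (hg q) (fun i => x (K q + i)) z (c (K q))
      (fun i => c (K q + i) + m q) (fun i => c (K q + i) + m q + (L q - 1))
      (K (q + 1) - K q) (by omega) (fun i hi => by simp) (by simp) (by
        intro i hi
        have h1 := hcs (K q + i)
        rw [hpK q i (by omega)] at h1
        have := hL q
        rw [← add_assoc (K q), h1]
        omega)
    refine ⟨y, hy1, fun k hk j hj => ?_⟩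
    have h1 := hp k
    rw [hk] at h1
    have := hy2 (k - K q) (by omega) j (by omega)
    rwa [Nat.add_sub_cancel' h1.1] at this
  choose y hy1 hy2 using hstep
  let Z : ℕ → X := fun q => Nat.rec (x 0) (fun q z => y q z) q
  have hZ : ∀ q, Z (q + 1) = y q (Z q) := fun q => rfl
  have hbd : ∀ k j, j < L (p k) → ∀ q ≥ p k,
      dist (T^[c k + m (p k) + j] (Z (q + 1))) (T^[j] (x k)) ≤ 2 * e (p k) - e q := by
    intro k j hj q hq
    induction q, hq using Nat.le_induction with
    | base => 
      rw [hZ]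
      have := hy2 (p k) (Z (p k)) k rfl j hj
      linarith
    | succ q hq ih =>
      rw [hZ]
      have h1 : c k + m (p k) + j < c (K (q + 1)) := by
        have h2 : k + 1 ≤ K (q + 1) := (hp k).2.trans_le (hK.monotone (by omega))
        have h3 := hcm.monotone h2
        have h4 := hcs k
        omega
      have h2 := hy1 (q + 1) (Z (q + 1)) _ h1
      have h3 := dist_triangle (T^[c k + m (p k) + j] (y (q + 1) (Z (q + 1))))
        (T^[c k + m (p k) + j] (Z (q + 1))) (T^[j] (x k))
      linarith [he q]
  have hepos : ∀ q, 0 < e q := by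
    intro q
    have h1 := hp (K q)
    have h2 : p (K q) = q := blocks_unique hK h1.1 h1.2 le_rfl (hK (Nat.lt_succ_self q))
    have := hy2 q (Z q) (K q) h2 0 (hL q)
    exact dist_nonneg.trans_lt this
  obtain ⟨z, -, φ, hφ, hz⟩ := (isCompact_univ (X := X)).tendsto_subseq (x := Z) fun _ => Set.mem_univ _
  refine ⟨z, fun k j hj => ?_⟩
  have hlim : Tendsto (fun i => dist (T^[c k + m (p k) + j] (Z (φ i))) (T^[j] (x k))) atTop
      (𝓝 (dist (T^[c k + m (p k) + j] z) (T^[j] (x k)))) :=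
    (((hT.iterate _).tendsto z).comp hz).dist tendsto_const_nhds
  refine le_of_tendsto hlim ?_
  filter_upwards [hφ.tendsto_atTop.eventually_ge_atTop (p k + 1)] with i hi
  obtain ⟨q, hq⟩ : ∃ q, φ i = q + 1 := ⟨φ i - 1, by omega⟩
  rw [hq]
  exact (hbd k j hj q (by omega)).trans (by linarith [hepos q])
end InfSpec


section Moran
variable {X : Type*} [MetricSpace X] 

open Classical in
theorem cover_count {T : X → X} (G L : ℕ → ℕ) (S : ℕ → Finset X) (s ε ε0 : ℝ) (rad : ℕ → ℝ)
    (hS : ∀ k, Real.exp (s * L k) ≤ (S k).card)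
    (hsep : ∀ k, ∀ x ∈ S k, ∀ y ∈ S k, y ∈ bowenBall T (L k) ε0 x → x = y)
    (hrad : ∀ k, 2 * ε + 2 * rad k ≤ ε0) (E : Set X)
    (hz : ∀ x : ℕ → X, (∀ k, x k ∈ S k) → ∃ z ∈ E, ∀ k, ∀ j < L k,
      dist (T^[csum (fun k => G k + L k) k + G k + j] z) (T^[j] (x k)) ≤ rad k)
    (jj : ℕ → ℕ) (hjj : ∀ n, csum (fun k => G k + L k) (jj n) ≤ n)
    (I : Finset ℕ) (pt : ℕ → X × ℕ) (hI : E ⊆ ⋃ i ∈ I, bowenBall T (pt i).2 ε (pt i).1) :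
    1 ≤ ∑ i ∈ I, Real.exp (-(s * ∑ k ∈ Finset.range (jj (pt i).2), (L k : ℝ))) := by
  set c := csum (fun k => G k + L k) with hc
  have hcm : Monotone c := fun a b hab =>
    Finset.sum_le_sum_of_subset (Finset.range_mono hab)
  have hcs : ∀ k, c (k + 1) = c k + (G k + L k) := fun k => csum_succ _ k
  have hcard : ∀ k, (0:ℝ) < (S k).card := fun k => (Real.exp_pos _).trans_le (hS k)
  have hne : ∀ k, (S k).Nonempty := fun k => Finset.card_pos.1 (by exact_mod_cast hcard k)
  choose d hd using hne
  set N := I.sup (fun i => jj (pt i).2) with hN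
  let Ω : Finset (Fin N → X) := Fintype.piFinset fun k : Fin N => S k
  let ext : (Fin N → X) → ℕ → X := fun w k => if h : k < N then w ⟨k, h⟩ else d k
  have hext : ∀ w ∈ Ω, ∀ k, ext w k ∈ S k := by
    intro w hw k
    by_cases h : k < N
    · simp only [ext, h, dif_pos]
      exact Fintype.mem_piFinset.1 hw ⟨k, h⟩
    · simp only [ext, h, dif_neg, not_false_iff]
      exact hd k
  have hzz : ∀ w ∈ Ω, ∃ z ∈ E, ∀ k, ∀ j < L k,
      dist (T^[c k + G k + j] z) (T^[j] (ext w k)) ≤ rad k := fun w hw => hz _ (hext w hw)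
  have hX : Nonempty X := ⟨d 0⟩
  choose! Z hZE hZ using hzz
  let A : ℕ → Finset (Fin N → X) := fun i =>
    Ω.filter fun w => Z w ∈ bowenBall T (pt i).2 ε (pt i).1
  have hcov : Ω ⊆ I.biUnion A := by
    intro w hw
    have := hI (hZE w hw)
    simp only [Set.mem_iUnion] at this
    obtain ⟨i, hi, h⟩ := this
    exact Finset.mem_biUnion.2 ⟨i, hi, Finset.mem_filter.2 ⟨hw, h⟩⟩
  have hΩ : (0:ℝ) < Ω.card := by
    rw [Fintype.card_piFinset]
    push_cast
    exact Finset.prod_pos fun k _ => hcard k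
  have hA : ∀ i ∈ I, ((A i).card : ℝ) ≤
      Ω.card * Real.exp (-(s * ∑ k ∈ Finset.range (jj (pt i).2), (L k : ℝ))) := by
    intro i hi
    set J := jj (pt i).2 with hJ
    have hJN : J ≤ N := Finset.le_sup (f := fun i => jj (pt i).2) hi
    by_cases hAe : (A i).Nonempty
    swap
    · rw [Finset.not_nonempty_iff_eq_empty.1 hAe]; simp; positivity
    obtain ⟨w0, hw0⟩ := hAe
    have hsub : A i ⊆ Fintype.piFinset fun k : Fin N => if (k:ℕ) < J then {w0 k} else S k := by
      intro w hw
      rw [Fintype.mem_piFinset]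
      intro k
      obtain ⟨hwΩ, hwB⟩ := Finset.mem_filter.1 hw
      obtain ⟨hwΩ0, hwB0⟩ := Finset.mem_filter.1 hw0
      split_ifs with hk
      · rw [Finset.mem_singleton]
        refine hsep k _ (Fintype.mem_piFinset.1 hwΩ k) _ (Fintype.mem_piFinset.1 hwΩ0 k) ?_
        intro j hj
        have e1 := hZ w hwΩ k j hj
        have e2 := hZ w0 hwΩ0 k j hj
        have e3 : ∀ v : Fin N → X, ext v k = v k := fun v => by simp [ext]
        rw [e3] at e1 e2
        have hlt : c k + G k + j < (pt i).2 := by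
          have h1 := hcm (show (k:ℕ) + 1 ≤ J from hk)
          have h2 := hcs k
          have h3 := hjj (pt i).2
          rw [← hJ] at h3
          omega
        have e4 := hwB _ hlt
        have e5 := hwB0 _ hlt
        rw [dist_comm] at e1 e4
        have t1 := dist_triangle4 (T^[j] (w k)) (T^[c k + G k + j] (Z w))
          (T^[c k + G k + j] (Z w0)) (T^[j] (w0 k))
        have t2 := dist_triangle (T^[c k + G k + j] (Z w)) (T^[c k + G k + j] (pt i).1)
          (T^[c k + G k + j] (Z w0))
        linarith [hrad k]
      · exact Fintype.mem_piFinset.1 hwΩ k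
    have h1 : ((A i).card : ℝ) ≤ ∏ k : Fin N, (if (k:ℕ) < J then (1:ℝ) else (S k).card) := by
      have := Finset.card_le_card hsub
      rw [Fintype.card_piFinset] at this
      refine (Nat.cast_le (α := ℝ).2 this).trans (le_of_eq ?_)
      push_cast
      refine Finset.prod_congr rfl fun k _ => ?_
      split_ifs <;> simp
    refine h1.trans ?_
    have h2 : ∏ k : Fin N, (if (k:ℕ) < J then (1:ℝ) else (S k).card) ≤
        ∏ k : Fin N, ((S k).card * Real.exp (-(s * if (k:ℕ) < J then (L k:ℝ) else 0))) := by
      refine Finset.prod_le_prod (fun k _ => by split_ifs <;> positivity) fun k _ => ?_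
      split_ifs
      · calc (1:ℝ) = Real.exp (s * L k) * Real.exp (-(s * L k)) := by rw [← Real.exp_add]; simp
          _ ≤ _ := by gcongr; exact hS k
      · simp
    refine h2.trans (le_of_eq ?_)
    rw [Finset.prod_mul_distrib, ← Real.exp_sum, Fintype.card_piFinset]
    push_cast
    congr 2
    rw [Finset.sum_neg_distrib, ← Finset.mul_sum]
    congr 2
    rw [Fin.sum_univ_eq_sum_range (fun k => if k < J then (L k:ℝ) else 0) N, ← Finset.sum_filter]
    refine Finset.sum_congr ?_ fun _ _ => rfl
    ext k; simp; omega
  have h3 : (Ω.card : ℝ) ≤ ∑ i ∈ I, ((A i).card : ℝ) := by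
    exact_mod_cast (Finset.card_le_card hcov).trans Finset.card_biUnion_le
  have h4 := h3.trans (Finset.sum_le_sum hA)
  rw [← Finset.mul_sum] at h4
  by_contra hlt
  push Not at hlt
  nlinarith

theorem isOpen_bowenBall {T : X → X} (hT : Continuous T) (n : ℕ) (ε : ℝ) (x : X) :
    IsOpen (bowenBall T n ε x) := by
  have : bowenBall T n ε x = ⋂ j ∈ Finset.range n, {y | dist (T^[j] x) (T^[j] y) < ε} := by
    ext y; simp [bowenBall]
  rw [this]
  exact isOpen_biInter_finset fun j _ =>
    isOpen_lt (continuous_const.dist (hT.iterate j)) continuous_const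

/-- Lower bound for Bowen entropy from a counting estimate. -/
theorem htop_ge {T : X → X} (hT : Continuous T) (E : Set X) (F : Set X) (hF : IsCompact F)
    (hFE : F ⊆ E) (ε : ℝ) (hε : 0 < ε) (s : ℝ≥0) (n0 : ℕ)
    (h : ∀ (I : Finset ℕ) (pt : ℕ → X × ℕ), (∀ i, n0 ≤ (pt i).2) →
      F ⊆ ⋃ i ∈ I, bowenBall T (pt i).2 ε (pt i).1 →
      1 ≤ ∑ i ∈ I, Real.exp (-(s * (pt i).2))) : (s : ℝ≥0∞) ≤ htop T E := by
  refine le_trans ?_ (le_iSup₂ (f := fun (ε : ℝ) (_ : 0 < ε) => bowenEnt T E ε) ε hε)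
  refine le_iInf₂ fun t ht => ?_
  by_contra hlt
  push Not at hlt
  have hts : t < s := by exact_mod_cast hlt
  have h1 : bowenHn T E t ε n0 < 1 := by
    have : bowenHn T E t ε n0 ≤ bowenH T E t ε := le_iSup (fun n => bowenHn T E t ε n) n0
    rw [ht] at this
    exact this.trans_lt one_pos
  unfold bowenHn at h1
  simp only [iInf_lt_iff] at h1
  obtain ⟨pt, hcov, hn, hsum⟩ := h1
  obtain ⟨I, hI⟩ := hF.elim_finite_subcover _ (fun i => isOpen_bowenBall hT (pt i).2 ε (pt i).1)
    (hFE.trans hcov)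
  have h2 := h I pt hn hI
  have h3 : ∑ i ∈ I, ENNReal.ofReal (Real.exp (-(t * (pt i).2))) < 1 :=
    (ENNReal.sum_le_tsum I).trans_lt hsum
  rw [← ENNReal.ofReal_sum_of_nonneg (fun _ _ => (Real.exp_pos _).le)] at h3
  have h4 : ∑ i ∈ I, Real.exp (-(t * (pt i).2)) < 1 := by
    rw [← ENNReal.ofReal_one] at h3
    exact (ENNReal.ofReal_lt_ofReal_iff one_pos).1 h3
  have h5 : ∑ i ∈ I, Real.exp (-(s * (pt i).2)) ≤ ∑ i ∈ I, Real.exp (-((t:ℝ) * (pt i).2)) := by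
    refine Finset.sum_le_sum fun i _ => Real.exp_le_exp.2 ?_
    have : (t:ℝ) ≤ s := by exact_mod_cast hts.le
    have : (t:ℝ) * (pt i).2 ≤ s * (pt i).2 := by gcongr
    linarith
  linarith

variable [CompactSpace X] [MeasurableSpace X] [BorelSpace X]

open Classical in
theorem stage_data (μ : Measure X) [IsProbabilityMeasure μ] {T : X → X} (hT : Continuous T)
    (hspec : Specification T)
    (hμ : MeasurePreserving T μ μ) {k : ℕ} (P : X → Fin k) (hP : Measurable P) (h s : ℝ)
    (hh : ∀ n : ℕ, (n + 1) * h ≤ partEntropy μ (nm T P (n + 1))) (hs : 0 ≤ s) (hsh : s < h) :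
    ∃ ε0 > 0, ∀ N : ℕ → ℕ, ∃ (L : ℕ → ℕ) (S : ℕ → Finset X), (∀ q, N q ≤ L q) ∧ (∀ q, 1 ≤ L q) ∧
      (∀ q, Real.exp (s * L q) ≤ (S q).card) ∧
      (∀ q, ∀ x ∈ S q, ∀ y ∈ S q, y ∈ bowenBall T (L q) ε0 x → x = y) ∧
      ∀ (f : C(X, ℝ)) (ε : ℝ), 0 < ε → ∀ᶠ q in atTop, ∀ x ∈ S q,
        |∑ j ∈ Finset.range (L q), f (T^[j] x) - L q * ∫ x, f x ∂μ| ≤ ε * L q := by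
  obtain ⟨ε0, hε0, H⟩ := good_segments μ hT hspec hμ P hP h s hh hs hsh
  refine ⟨ε0, hε0, fun N => ?_⟩
  have H' := fun q : ℕ => H ((Finset.range q).image (TopologicalSpace.denseSeq C(X, ℝ)))
    (1 / ((q:ℝ) + 1)) (by positivity) (N q)
  choose L hL1 hL2 S hS1 hS2 hS3 using H'
  refine ⟨L, S, hL1, hL2, hS1, hS2, fun f ε hε => ?_⟩
  obtain ⟨_, ⟨i, rfl⟩, hi⟩ := Metric.mem_closure_range_iff.1
    (TopologicalSpace.denseRange_denseSeq C(X, ℝ) f) (ε / 3) (by positivity) |>.elim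
      (fun i hi => (⟨_, ⟨i, rfl⟩, hi⟩ : ∃ g ∈ Set.range (TopologicalSpace.denseSeq C(X, ℝ)),
        dist f g < ε / 3))
  set g := TopologicalSpace.denseSeq C(X, ℝ) i with hg
  have hfg : ∀ x, |f x - g x| ≤ ε / 3 := fun x => by
    have := (ContinuousMap.dist_apply_le_dist (f := f) (g := g) x).trans hi.le
    rwa [Real.dist_eq] at this
  have hInteg : ∀ f : C(X, ℝ), Integrable f μ := fun f =>
    f.continuous.integrable_of_hasCompactSupport (HasCompactSupport.of_compactSpace _)
  have hI : |∫ x, f x ∂μ - ∫ x, g x ∂μ| ≤ ε / 3 := by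
    rw [← integral_sub (hInteg f) (hInteg g)]
    have := norm_integral_le_of_norm_le_const (μ := μ) (f := fun x => f x - g x) (C := ε / 3)
      (Filter.Eventually.of_forall fun x => hfg x)
    simpa using this
  obtain ⟨q0, hq0⟩ := exists_nat_one_div_lt (show (0:ℝ) < ε / 3 by positivity)
  filter_upwards [eventually_gt_atTop i, eventually_ge_atTop q0] with q hqi hq x hx
  have h1 := hS3 q x hx g (Finset.mem_image.2 ⟨i, Finset.mem_range.2 hqi, rfl⟩)
  have h2 : 1 / ((q:ℝ) + 1) ≤ ε / 3 := by
    refine le_trans ?_ hq0.le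
    gcongr
  have h3 : |∑ j ∈ Finset.range (L q), f (T^[j] x) - ∑ j ∈ Finset.range (L q), g (T^[j] x)| ≤ L q * (ε / 3) := by
    rw [← Finset.sum_sub_distrib]
    refine (Finset.abs_sum_le_sum_abs _ _).trans ?_
    refine (Finset.sum_le_sum fun j _ => hfg _).trans ?_
    simp
  have h4 : |(L q : ℝ) * ∫ x, f x ∂μ - L q * ∫ x, g x ∂μ| ≤ L q * (ε / 3) := by
    rw [← mul_sub, abs_mul, Nat.abs_cast]; gcongr
  have h5 : 1 / ((q:ℝ) + 1) * L q ≤ ε / 3 * L q := by gcongr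
  rw [abs_le] at *
  constructor <;> linarith
end Moran


section Lower
variable {X : Type*} [MetricSpace X] [CompactSpace X] [MeasurableSpace X] [BorelSpace X]

/-- A point whose Birkhoff averages all converge to those of `μ` lies in the level set. -/
theorem mem_Eset_of_generic (μ : Measure X) [IsProbabilityMeasure μ] {T : X → X} (hT : Continuous T)
    (hμ : MeasurePreserving T μ μ) {r : ℕ} (Φ : (Fin r → X) → ℝ) (hΦ : Continuous Φ) (z : X)
    (hz : ∀ f : C(X, ℝ), Tendsto (fun n : ℕ => (∑ t ∈ Finset.range n, f (T^[t] z)) / n) atTop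
      (𝓝 (∫ x, f x ∂μ))) :
    z ∈ Eset T Φ (∫ y, Φ y ∂(Measure.pi fun _ : Fin r => μ)) := by
  let ν : ℕ → ProbabilityMeasure X := fun n =>
    ⟨emp (fun i : Fin (n + 1) => T^[(i:ℕ) + 1] z), emp_isProb _⟩
  let μ' : ProbabilityMeasure X := ⟨μ, inferInstance⟩
  have hν : Tendsto ν atTop (𝓝 μ') := by
    rw [ProbabilityMeasure.tendsto_iff_forall_integral_tendsto]
    intro f
    have h1 := hz ⟨fun x => f (T x), f.continuous.comp hT⟩
    have h2 := (tendsto_add_atTop_iff_nat 1).2 h1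
    have h3 : ∫ x, f (T x) ∂μ = ∫ x, f x ∂μ := by
      rw [← integral_map (φ := T) hμ.aemeasurable f.continuous.measurable.aestronglyMeasurable, hμ.map_eq]
    simp only [ContinuousMap.coe_mk, h3] at h2
    refine h2.congr fun n => ?_
    simp only [ν, ProbabilityMeasure.coe_mk]
    rw [integral_emp]
    rw [Finset.sum_range]
    simp [Function.iterate_succ_apply', div_eq_inv_mul]
  have h4 := tendsto_integral_pi (r := r) hΦ hν
  refine (tendsto_add_atTop_iff_nat 1).1 ?_
  refine h4.congr fun n => ?_
  rw [Vstat_eq T Φ (n + 1) (by omega) z]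
  rfl
end Lower


section Lower2
variable {X : Type*} [MetricSpace X] [CompactSpace X] [MeasurableSpace X] [BorelSpace X]

theorem generic_of_cells (μ : Measure X) [IsProbabilityMeasure μ] {T : X → X}
    (m L : ℕ → ℕ) (S : ℕ → Finset X) (e : ℕ → ℝ) (he : Tendsto e atTop (𝓝 0))
    (hL : ∀ q, 1 ≤ L q) (hmL : ∀ q, q * m q ≤ L q)
    (hS : ∀ (f : C(X, ℝ)) (ε : ℝ), 0 < ε → ∀ᶠ q in atTop, ∀ x ∈ S q,
        |∑ j ∈ Finset.range (L q), f (T^[j] x) - L q * ∫ x, f x ∂μ| ≤ ε * L q)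
    (p : ℕ → ℕ) (hp : Tendsto p atTop atTop)
    (hsmall : ∀ ε : ℝ, 0 < ε → ∀ᶠ k in atTop, ((m (p k) + L (p k) : ℕ) : ℝ) ≤
      ε * csum (fun k => m (p k) + L (p k)) k) (z : X)
    (hz : ∀ k, ∃ x ∈ S (p k), ∀ j < L (p k),
      dist (T^[csum (fun k => m (p k) + L (p k)) k + m (p k) + j] z) (T^[j] x) ≤ e (p k))
    (f : C(X, ℝ)) :
    Tendsto (fun n : ℕ => (∑ t ∈ Finset.range n, f (T^[t] z)) / n) atTop (𝓝 (∫ x, f x ∂μ)) := by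
  set c := csum (fun k => m (p k) + L (p k)) with hc
  set I := ∫ x, f x ∂μ with hI
  have hCf : ∀ x, |f x| ≤ ‖f‖ := fun x => f.norm_coe_le_norm x
  have hCI : |I| ≤ ‖f‖ := by
    have := norm_integral_le_of_norm_le_const (μ := μ) (f := f) (C := ‖f‖)
      (Filter.Eventually.of_forall fun x => hCf x)
    simpa using this
  have hu : ∀ t, |f (T^[t] z) - I| ≤ 2 * ‖f‖ := fun t => (abs_sub _ _).trans (by linarith [hCf (T^[t] z)])
  have key := avg_tendsto (fun t => f (T^[t] z) - I) (2 * ‖f‖) hu (fun k => m (p k) + L (p k))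
    (fun k => by have := hL (p k); omega) ?_ hsmall
  · have h2 := key.add_const I
    rw [zero_add] at h2
    refine h2.congr' ?_
    filter_upwards [eventually_gt_atTop 0] with n hn
    have : (0:ℝ) < n := by exact_mod_cast hn
    rw [Finset.sum_sub_distrib]
    simp
    field_simp
    ring
  · intro ε hε
    obtain ⟨d, hd, hfd⟩ := Metric.uniformContinuous_iff.1
        (CompactSpace.uniformContinuous_of_continuous f.continuous) (ε / 3) (by positivity)
    obtain ⟨Q, hQ⟩ := exists_nat_ge (2 * ‖f‖ / (ε / 3))
    filter_upwards [hp.eventually (hS f (ε / 3) (by positivity)), hp.eventually_ge_atTop Q,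
      hp.eventually (he.eventually (gt_mem_nhds hd))] with k h1 h2 h3
    obtain ⟨x, hx, hxz⟩ := hz k
    have h1x := h1 x hx
    set q := p k
    rw [Finset.sum_range_add]
    have e1 : |∑ t ∈ Finset.range (m q), (f (T^[c k + t] z) - I)| ≤ m q * (2 * ‖f‖) := by
      refine (Finset.abs_sum_le_sum_abs _ _).trans ?_
      refine (Finset.sum_le_sum fun j _ => hu _).trans ?_
      simp
    have e2 : |∑ j ∈ Finset.range (L q), (f (T^[c k + (m q + j)] z) - I)
        - (∑ j ∈ Finset.range (L q), f (T^[j] x) - L q * I)| ≤ L q * (ε / 3) := by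
      have : ∑ j ∈ Finset.range (L q), (f (T^[c k + (m q + j)] z) - I)
        - (∑ j ∈ Finset.range (L q), f (T^[j] x) - L q * I) =
          ∑ j ∈ Finset.range (L q), (f (T^[c k + (m q + j)] z) - f (T^[j] x)) := by
        simp only [Finset.sum_sub_distrib]; simp
      rw [this]
      refine (Finset.abs_sum_le_sum_abs _ _).trans ?_
      refine (Finset.sum_le_sum (g := fun _ => ε / 3) fun j hj => ?_).trans (by simp)
      have := hxz j (Finset.mem_range.1 hj)
      have h4 := hfd (lt_of_le_of_lt this h3)
      rw [Real.dist_eq, add_assoc] at h4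
      exact h4.le
    have e3 : m q * (2 * ‖f‖) ≤ ε / 3 * L q := by
      rw [div_le_iff₀ (by positivity)] at hQ
      calc m q * (2 * ‖f‖) ≤ m q * (Q * (ε / 3)) := by gcongr
        _ ≤ m q * (q * (ε / 3)) := by gcongr
        _ = ε / 3 * (q * m q : ℕ) := by push_cast; ring
        _ ≤ ε / 3 * L q := by gcongr; exact hmL q
    have e4 : 0 ≤ ε * m q := by positivity
    push_cast
    rw [abs_le] at *
    constructor <;> linarith

theorem moran (μ : Measure X) [IsProbabilityMeasure μ] {T : X → X} (hT : Continuous T)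
    (hspec : Specification T)
    (hμ : MeasurePreserving T μ μ) {k : ℕ} (P : X → Fin k) (hP : Measurable P) (h s : ℝ) (s' : ℝ≥0)
    (hh : ∀ n : ℕ, (n + 1) * h ≤ partEntropy μ (nm T P (n + 1))) (hs : s' < s) (hsh : s < h)
    {r : ℕ} (Φ : (Fin r → X) → ℝ) (hΦ : Continuous Φ) :
    (s' : ℝ≥0∞) ≤ htop T (Eset T Φ (∫ y, Φ y ∂(Measure.pi fun _ : Fin r => μ))) := by
  have hs0 : 0 < s := s'.2.trans_lt hs
  obtain ⟨B, hB1, hB⟩ : ∃ B : ℕ, 1 ≤ B ∧ s' * ((B:ℝ) + 1) ^ 2 ≤ s * (B:ℝ) ^ 2 := by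
    obtain ⟨B, hB⟩ := exists_nat_ge (3 * s' / (s - s'))
    refine ⟨B + 1, by omega, ?_⟩
    rw [div_le_iff₀ (by linarith)] at hB
    have hs'0 : (0:ℝ) ≤ s' := s'.2
    push_cast
    have hB0 : (0:ℝ) ≤ B := by positivity
    nlinarith [mul_nonneg hB0 hB0, mul_nonneg hB0 hs'0, mul_nonneg hB0 hs0.le]
  obtain ⟨ε0, hε0, H⟩ := stage_data μ hT hspec hμ P hP h s hh hs0.le hsh
  set e : ℕ → ℝ := fun q => ε0 / 8 / 2 ^ q with he
  have hepos : ∀ q, 0 < e q := fun q => by positivity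
  have he2 : ∀ q, 2 * e (q + 1) ≤ e q := fun q => by
    simp only [he]; rw [pow_succ]; apply le_of_eq; field_simp
  have hele : ∀ q, e q ≤ ε0 / 8 := fun q => div_le_self (by positivity) (one_le_pow₀ (by norm_num))
  have helim : Tendsto (fun q => 2 * e q) atTop (𝓝 0) := by
    have : Tendsto (fun q : ℕ => 2 * (ε0 / 8) * (1 / 2 : ℝ) ^ q) atTop (𝓝 0) := by
      simpa using (tendsto_pow_atTop_nhds_zero_of_lt_one (by norm_num : (0:ℝ) ≤ 1/2)
        (by norm_num)).const_mul (2 * (ε0 / 8))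
    refine this.congr fun q => ?_
    simp [he]; field_simp
  choose m hm1 hgap using fun q => hspec (e q) (hepos q)
  obtain ⟨L, S, hLN, hL1, hScard, hSsep, hSf⟩ := H (fun q => B * (q + 1) * m q)
  have hBm : ∀ q, B * m q ≤ L q := fun q => le_trans (by
    rw [mul_right_comm]; exact Nat.le_mul_of_pos_right _ (by omega)) (hLN q)
  have hmL : ∀ q, q * m q ≤ L q := fun q => le_trans (Nat.mul_le_mul_right _ (by
    calc q ≤ 1 * (q + 1) := by omega
      _ ≤ B * (q + 1) := Nat.mul_le_mul_right _ hB1)) (hLN q)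
  -- schedule
  set K := csum (fun i => 1 + (i + 1) * (m (i + 1) + L (i + 1))) with hK
  have hKm : StrictMono K := csum_strictMono _ fun k => by omega
  have hK0 : K 0 = 0 := by simp [hK, csum]
  have hKb : ∀ q, q * (m q + L q) ≤ K q := by
    intro q
    cases q with
    | zero => simp
    | succ q => rw [hK, csum_succ]; omega
  obtain ⟨p, hp⟩ := exists_blocks K hKm hK0
  have hplim : Tendsto p atTop atTop := by
    rw [tendsto_atTop_atTop]
    intro q
    refine ⟨K q, fun k hk => ?_⟩
    have := hKm.lt_iff_lt.1 (hk.trans_lt (hp k).2)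
    omega
  set ℓ : ℕ → ℕ := fun k => m (p k) + L (p k) with hℓ
  have hℓ1 : ∀ k, 1 ≤ ℓ k := fun k => by have := hL1 (p k); simp only [hℓ]; omega
  set c := csum ℓ with hc
  have hcm : StrictMono c := csum_strictMono ℓ hℓ1
  have hc0 : c 0 = 0 := by simp [hc, csum]
  have hpl : ∀ k, p k * ℓ k ≤ c k := fun k =>
    (hKb (p k)).trans ((hp k).1.trans hcm.le_apply)
  have hsmall : ∀ ε : ℝ, 0 < ε → ∀ᶠ k in atTop, ((m (p k) + L (p k) : ℕ) : ℝ) ≤ ε * c k := by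
    intro ε hε
    obtain ⟨Q, hQ⟩ := exists_nat_ge (1 / ε)
    filter_upwards [hplim.eventually_ge_atTop Q] with k hk
    rw [div_le_iff₀ hε] at hQ
    calc ((m (p k) + L (p k) : ℕ) : ℝ) = 1 * (ℓ k : ℝ) := by simp [hℓ]
      _ ≤ (Q * ε) * ℓ k := by gcongr
      _ ≤ (p k * ε) * ℓ k := by gcongr
      _ = ε * (p k * ℓ k : ℕ) := by push_cast; ring
      _ ≤ ε * c k := by gcongr; exact hpl k
  -- the Moran set
  let F : Set X := {z | ∀ k, ∃ x ∈ S (p k), ∀ j < L (p k),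
      dist (T^[c k + m (p k) + j] z) (T^[j] x) ≤ 2 * e (p k)}
  have hFc : IsCompact F := by
    refine IsClosed.isCompact ?_
    have : F = ⋂ k, ⋃ x ∈ S (p k), ⋂ j ∈ Finset.range (L (p k)),
        {z | dist (T^[c k + m (p k) + j] z) (T^[j] x) ≤ 2 * e (p k)} := by
      ext z; simp [F]
    rw [this]
    refine isClosed_iInter fun k => isClosed_biUnion_finset fun x _ => 
      isClosed_biInter fun j _ => isClosed_le ((hT.iterate _).dist continuous_const) continuous_const
  have hFE : F ⊆ Eset T Φ (∫ y, Φ y ∂(Measure.pi fun _ : Fin r => μ)) := by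
    intro z hz
    refine mem_Eset_of_generic μ hT hμ Φ hΦ z fun f => ?_
    exact generic_of_cells μ m L S (fun q => 2 * e q) helim hL1 hmL hSf p hplim hsmall z hz f
  obtain ⟨jj, hjj⟩ := exists_blocks c hcm hc0
  have hn0 : ∃ n0, ∀ n ≥ n0, (s' : ℝ) * n ≤ s * ∑ k ∈ Finset.range (jj n), (L (p k) : ℝ) := by
    have hBpos : (0:ℝ) < B := by exact_mod_cast hB1
    obtain ⟨k0, hk0⟩ := eventually_atTop.1 (hsmall (1 / B) (by positivity))
    refine ⟨c k0, fun n hn => ?_⟩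
    obtain ⟨h1, h2⟩ := hjj n
    set J := jj n
    have hJ : k0 ≤ J := by
      have := hcm.lt_iff_lt.1 (lt_of_le_of_lt hn h2)
      omega
    set Λ : ℝ := ∑ k ∈ Finset.range J, (L (p k) : ℝ) with hΛ
    have a1 : B * (c J : ℝ) ≤ (B + 1) * Λ := by
      rw [hc, csum, hΛ, Nat.cast_sum, Finset.mul_sum, Finset.mul_sum]
      refine Finset.sum_le_sum fun k _ => ?_
      have : (B:ℝ) * m (p k) ≤ L (p k) := by exact_mod_cast hBm (p k)
      simp only [hℓ]
      push_cast
      linarith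
    have a2 : B * (n:ℝ) ≤ (B + 1) * c J := by
      have b1 : (n:ℝ) ≤ c J + ℓ J := by
        rw [hc, csum_succ] at h2
        exact_mod_cast h2.le
      have b2 : (ℓ J : ℝ) ≤ 1 / B * c J := hk0 J hJ
      have b3 : B * (ℓ J : ℝ) ≤ c J := by
        calc B * (ℓ J : ℝ) ≤ B * (1 / B * c J) := by gcongr
          _ = c J := by field_simp
      nlinarith
    have a3 : (B:ℝ) ^ 2 * n ≤ (B + 1) ^ 2 * Λ := by
      calc (B:ℝ) ^ 2 * n = B * (B * n) := by ring
        _ ≤ B * ((B + 1) * c J) := by gcongr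
        _ = (B + 1) * (B * c J) := by ring
        _ ≤ (B + 1) * ((B + 1) * Λ) := by gcongr
        _ = _ := by ring
    have hΛ0 : 0 ≤ Λ := Finset.sum_nonneg fun _ _ => by positivity
    have a4 : (B:ℝ) ^ 2 * (s' * n) ≤ (B:ℝ) ^ 2 * (s * Λ) := by
      calc (B:ℝ) ^ 2 * (s' * n) = s' * ((B:ℝ) ^ 2 * n) := by ring
        _ ≤ s' * ((B + 1) ^ 2 * Λ) := by gcongr
        _ = (s' * (B + 1) ^ 2) * Λ := by ring
        _ ≤ (s * (B:ℝ) ^ 2) * Λ := by gcongr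
        _ = _ := by ring
    exact le_of_mul_le_mul_left a4 (by positivity)
  obtain ⟨n0, hn0⟩ := hn0
  refine htop_ge hT _ F hFc hFE (ε0 / 8) (by positivity) s' n0 fun I pt hpt hcov => ?_
  have hcount := cover_count (T := T) (fun k => m (p k)) (fun k => L (p k)) (fun k => S (p k))
    s (ε0 / 8) ε0 (fun k => 2 * e (p k)) (fun k => hScard _) (fun k => hSsep _)
    (fun k => by have := hele (p k); linarith) F (fun x hx => by
      obtain ⟨z, hz⟩ := inf_spec hT e he2 m L hgap hL1 K hKm hK0 p hp x
      exact ⟨z, fun k => ⟨x k, hx k, hz k⟩, hz⟩) jj (fun n => (hjj n).1) I pt hcov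
  refine hcount.trans (Finset.sum_le_sum fun i _ => Real.exp_le_exp.2 ?_)
  have := hn0 _ (hpt i)
  linarith

theorem lower_bound {T : X → X} (hT : Continuous T) (hspec : Specification T) {r : ℕ}
    (Φ : (Fin r → X) → ℝ) (hΦ : Continuous Φ) (α : ℝ) (μ : Measure X) (hμ : μ ∈ Mset T Φ α) :
    hKS T μ ≤ htop T (Eset T Φ α) := by
  obtain ⟨h1, h2, rfl⟩ := hμ
  refine ENNReal.le_of_forall_nnreal_lt ?_
  intro s' hs'
  unfold hKS at hs'
  simp only [lt_iSup_iff] at hs'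
  obtain ⟨k, P, hP, hlt⟩ := hs'
  set h := ⨅ n : ℕ,
      partEntropy μ (fun x => fun j : Fin (n + 1) => P (T^[(j : ℕ)] x)) / (n + 1) with hh
  have hlt' : (s' : ℝ) < h := by
    rw [← ENNReal.ofReal_coe_nnreal] at hlt
    exact (ENNReal.ofReal_lt_ofReal_iff_of_nonneg s'.2).1 hlt
  obtain ⟨s, hs1, hs2⟩ := exists_between hlt'
  refine moran μ hT hspec h2 P hP h s s' (fun n => ?_) hs1 hs2 Φ hΦ
  have hbdd : BddBelow (Set.range fun n : ℕ =>
      partEntropy μ (fun x => fun j : Fin (n + 1) => P (T^[(j : ℕ)] x)) / ((n:ℝ) + 1)) := by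
    refine ⟨0, ?_⟩
    rintro _ ⟨n, rfl⟩
    refine div_nonneg (Finset.sum_nonneg fun v _ => Real.negMulLog_nonneg ENNReal.toReal_nonneg ?_)
      (by positivity)
    exact measureReal_le_one (μ := μ)
  have := ciInf_le hbdd n
  rw [← hh, le_div_iff₀ (by positivity)] at this
  rw [mul_comm]
  exact this
end Lower2

/-- For a system with the specification property: if `M_Φ(α) = ∅` then
`E_Φ(α) = ∅`, and if `M_Φ(α) ≠ ∅` then `h_top(E_Φ(α)) = sup_{μ ∈ M_Φ(α)} h_μ`. -/
theorem variational_principle_of_specification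
    {X : Type*} [MetricSpace X] [CompactSpace X] [MeasurableSpace X] [BorelSpace X]
    (T : X → X) (hT : Continuous T) (hspec : Specification T) (r : ℕ) (hr : 1 ≤ r)
    (Φ : (Fin r → X) → ℝ) (hΦ : Continuous Φ) (α : ℝ) :
    (Mset T Φ α = ∅ → Eset T Φ α = ∅) ∧
    ((Mset T Φ α).Nonempty →
      htop T (Eset T Φ α) = ⨆ μ ∈ Mset T Φ α, hKS T μ) := by
  refine ⟨fun hM => ?_, fun hne => ?_⟩
  · by_contra hE
    obtain ⟨x, hx⟩ := Set.nonempty_iff_ne_empty.2 hE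
    exact (empty_case T hT r Φ hΦ α x hx).ne_empty hM
  · obtain ⟨μ, hμ⟩ := hne
    have h1 : IsProbabilityMeasure μ := hμ.1
    have hX : Nonempty X := nonempty_of_isProbabilityMeasure μ
    exact le_antisymm (upper_bound T hT r Φ hΦ α)
      (iSup₂_le fun ν hν => lower_bound hT hspec Φ hΦ α ν hν)
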